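/- arXiv:2006.11772 — 2 statements merged into one kernel-verified Lean document; each statement's English description precedes it below -/
import Mathlib

section
/- Let n1 ≥ 5 be even, n2 ≥ 1, n3 ≥ 2 and ℓ ≥ 1. Then the graph L^ℓ_{n1,n2,n3} satisfies dim(L^ℓ_{n1,n2,n3}) = n3 + ℓ and edim(L^ℓ_{n1,n2,n3}) = n3. -/
/-- `S` is a metric generator of `G`: every pair of distinct vertices is
identified by some vertex of `S` via distances. -/
def IsMetricGenerator {V : Type*} (G : SimpleGraph V) (S : Set V) : Prop :=
  ∀ u v : V, u ≠ v → ∃ z ∈ S, G.dist u z ≠ G.dist v z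

/-- The metric dimension of `G`: the least cardinality of a (finite) metric generator. -/
noncomputable def metricDim {V : Type*} (G : SimpleGraph V) : ℕ :=
  sInf {n | ∃ S : Set V, S.Finite ∧ IsMetricGenerator G S ∧ S.ncard = n}

/-- Distance from an edge (unordered pair) to a vertex:
`d(uv, z) = min (d u z) (d v z)`. -/
noncomputable def edgeDist {V : Type*} (G : SimpleGraph V) (e : Sym2 V) (z : V) : ℕ :=
  Sym2.lift ⟨fun u v => min (G.dist u z) (G.dist v z), fun u v => by simp [min_comm]⟩ e

/-- `S` is an edge metric generator of `G`: every pair of distinct edges is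
distinguished by some vertex of `S`. -/
def IsEdgeMetricGenerator {V : Type*} (G : SimpleGraph V) (S : Set V) : Prop :=
  ∀ e ∈ G.edgeSet, ∀ f ∈ G.edgeSet, e ≠ f → ∃ z ∈ S, edgeDist G e z ≠ edgeDist G f z

/-- The edge metric dimension of `G`: the least cardinality of a (finite) edge
metric generator. -/
noncomputable def edgeMetricDim {V : Type*} (G : SimpleGraph V) : ℕ :=
  sInf {n | ∃ S : Set V, S.Finite ∧ IsEdgeMetricGenerator G S ∧ S.ncard = n}
/-- Vertices of the graph `G_{n1,n2,n3}`: cycle vertices `a 0, …, a (n1-1)`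
(with `a k` standing for the paper's `a_{k+1}`), path vertices
`b 0, …, b (n2-1)`, the special vertices `c` and `i`, and pendant vertices
`j 0, …, j (n3-1)` attached to `i`. -/
inductive GVert (n1 n2 n3 : ℕ) : Type where
  | a : Fin n1 → GVert n1 n2 n3
  | b : Fin n2 → GVert n1 n2 n3
  | c : GVert n1 n2 n3
  | i : GVert n1 n2 n3
  | j : Fin n3 → GVert n1 n2 n3

/-- Base relation whose symmetrization gives the edges of `G_{n1,n2,n3}`:
the cycle `a_1 a_2 ⋯ a_{n1} a_1`, the path `b_1 b_2 ⋯ b_{n2}` joined by the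
edge `a_2 b_1`, the edge `a_{n1} c`, the edge `a_1 i`, and the pendant edges
`i j_t`. -/
def GRel (n1 n2 n3 : ℕ) : GVert n1 n2 n3 → GVert n1 n2 n3 → Prop
  | .a k, .a l => (l : ℕ) = ((k : ℕ) + 1) % n1
  | .a k, .b m => (k : ℕ) = 1 ∧ (m : ℕ) = 0
  | .b m, .b m' => (m' : ℕ) = (m : ℕ) + 1
  | .a k, .c => (k : ℕ) = n1 - 1
  | .a k, .i => (k : ℕ) = 0
  | .i, .j _ => True
  | _, _ => False

/-- The graph `G_{n1,n2,n3}` from the paper. -/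
def GGraph (n1 n2 n3 : ℕ) : SimpleGraph (GVert n1 n2 n3) :=
  SimpleGraph.fromRel (GRel n1 n2 n3)
/-- `x` is the vertex `a_α` of `G_{n1,n2,n3}`, where `α = ⌊(n1+1)/2⌋`
(recall `a k` stands for `a_{k+1}`). -/
def IsAlphaVert {n1 n2 n3 : ℕ} : GVert n1 n2 n3 → Prop
  | .a p => (p : ℕ) = (n1 + 1) / 2 - 1
  | _ => False

/-- `x` is the vertex `j_1` of `G_{n1,n2,n3}`. -/
def IsJOneVert {n1 n2 n3 : ℕ} : GVert n1 n2 n3 → Prop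
  | .j q => (q : ℕ) = 0
  | _ => False

/-- Vertices of `L^ℓ_{n1,n2,n3}`: the first copy `G_1 = G_{n1,n2,n3}` (the `inl`
part) together with `ℓ - 1` further copies `G_2 = ⋯ = G_ℓ = G_{n1,1,2}`
(the `inr` part, copy `G_{k+2}` being indexed by `k : Fin (ℓ-1)`). -/
abbrev LVert (n1 n2 n3 ℓ : ℕ) : Type :=
  GVert n1 n2 n3 ⊕ (Fin (ℓ - 1) × GVert n1 1 2)

/-- Base relation whose symmetrization gives the edges of `L^ℓ_{n1,n2,n3}`:
the edges inside each copy, together with the connecting edges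
`a_α^k j_1^{k+1}` for `k = 1, …, ℓ-1`. -/
def LRel (n1 n2 n3 ℓ : ℕ) : LVert n1 n2 n3 ℓ → LVert n1 n2 n3 ℓ → Prop
  | .inl x, .inl y => (GGraph n1 n2 n3).Adj x y
  | .inl x, .inr (k, y) => (k : ℕ) = 0 ∧ IsAlphaVert x ∧ IsJOneVert y
  | .inr (k, x), .inr (k', y) =>
      (k = k' ∧ (GGraph n1 1 2).Adj x y) ∨
        ((k' : ℕ) = (k : ℕ) + 1 ∧ IsAlphaVert x ∧ IsJOneVert y)
  | _, _ => False

/-- The graph `L^ℓ_{n1,n2,n3}` from the paper. -/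
def LGraph (n1 n2 n3 ℓ : ℕ) : SimpleGraph (LVert n1 n2 n3 ℓ) :=
  SimpleGraph.fromRel (LRel n1 n2 n3 ℓ)

namespace SimpleGraph

/-- A potential which vanishes at `z`, changes by at most one along edges and can be decreased
at every vertex other than `z` is the distance to `z`. -/
theorem dist_eq_of_potential {V : Type*} {G : SimpleGraph V} {z : V} (f : V → ℕ)
    (hz : f z = 0) (hlip : ∀ u v, G.Adj u v → f u ≤ f v + 1)
    (hdesc : ∀ u, u ≠ z → ∃ v, G.Adj u v ∧ f v + 1 = f u) (u : V) : G.dist u z = f u := by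
  have hwalk : ∀ n u, f u = n → ∃ p : G.Walk u z, p.length = n := by
    intro n
    induction n with
    | zero =>
      intro u hu
      by_cases h : u = z
      · subst h; exact ⟨.nil, rfl⟩
      · obtain ⟨v, -, hv⟩ := hdesc u h
        omega
    | succ n ih =>
      intro u hu
      have h : u ≠ z := by rintro rfl; omega
      obtain ⟨v, hadj, hv⟩ := hdesc u h
      obtain ⟨p, hp⟩ := ih v (by omega)
      exact ⟨.cons hadj p, by simp [hp]⟩
  have hlen : ∀ {u w : V} (p : G.Walk u w), f u ≤ f w + p.length := by
    intro u w p
    induction p with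
    | nil => simp
    | cons h p ih =>
      have := hlip _ _ h
      rw [Walk.length_cons]
      omega
  obtain ⟨p, hp⟩ := hwalk _ u rfl
  obtain ⟨q, hq⟩ := p.reachable.exists_walk_length_eq_dist
  have h1 := dist_le p
  have h2 := hlen q
  omega

end SimpleGraph

/-- Vertices of the graphs `G_{2m,n2,n3}` with natural number parameters, so that all copies
inside `L^ℓ_{n1,n2,n3}` share one type. -/
inductive GCode : Type where
  | a : ℕ → GCode
  | b : ℕ → GCode
  | c : GCode
  | i : GCode
  | j : ℕ → GCode

namespace GCode

/-- The code is that of a vertex of `G_{2m,n2,n3}`. -/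
def IsValid (m n2 n3 : ℕ) : GCode → Prop
  | a p => p < 2 * m
  | b t => t < n2
  | c => True
  | i => True
  | j t => t < n3

/-- The edges of `G_{2m,n2,n3}`, each in one direction. -/
def Arc (m : ℕ) : GCode → GCode → Prop
  | a p, a q => q = p + 1 ∨ (p + 1 = 2 * m ∧ q = 0)
  | a p, b t => p = 1 ∧ t = 0
  | b s, b t => t = s + 1
  | a p, c => p + 1 = 2 * m
  | a p, i => p = 0
  | i, j _ => True
  | _, _ => False

/-- Distance between two vertices of a cycle of length `2 * m`. -/
def cycleDist (m p q : ℕ) : ℕ := min ((p - q) + (q - p)) (2 * m - ((p - q) + (q - p)))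

/-- The distance in `G_{2m,n2,n3}`. -/
def codeDist (m : ℕ) : GCode → GCode → ℕ
  | a p, a q => cycleDist m p q
  | a p, b t => cycleDist m p 1 + t + 1
  | a p, c => cycleDist m p (2 * m - 1) + 1
  | a p, i => cycleDist m p 0 + 1
  | a p, j _ => cycleDist m p 0 + 2
  | b t, a p => cycleDist m p 1 + t + 1
  | b s, b t => (s - t) + (t - s)
  | b s, c => s + 4
  | b s, i => s + 3
  | b s, j _ => s + 4
  | c, a p => cycleDist m p (2 * m - 1) + 1
  | c, b s => s + 4
  | c, c => 0
  | c, i => 3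
  | c, j _ => 4
  | i, a p => cycleDist m p 0 + 1
  | i, b s => s + 3
  | i, c => 3
  | i, i => 0
  | i, j _ => 1
  | j _, a p => cycleDist m p 0 + 2
  | j _, b s => s + 4
  | j _, c => 4
  | j _, i => 1
  | j s, j t => if s = t then 0 else 2

theorem codeDist_self (m : ℕ) (x : GCode) : codeDist m x x = 0 := by
  cases x <;> simp [codeDist, cycleDist]

theorem codeDist_comm (m : ℕ) (x y : GCode) : codeDist m x y = codeDist m y x := by
  cases x <;> cases y <;> simp only [codeDist, cycleDist] <;> first | rfl | omega | simp [eq_comm]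

theorem codeDist_arc {m n2 n3 : ℕ} (hm : 3 ≤ m) {x x' y : GCode} (hx : x.IsValid m n2 n3)
    (hx' : x'.IsValid m n2 n3) (hy : y.IsValid m n2 n3) (h : Arc m x x') :
    codeDist m x y ≤ codeDist m x' y + 1 ∧ codeDist m x' y ≤ codeDist m x y + 1 := by
  cases x <;> cases x' <;> simp only [Arc] at h <;> cases y <;>
    simp only [codeDist, cycleDist, IsValid] at * <;> first | omega | (split <;> omega)

theorem exists_cycleDist_succ {m p q : ℕ} (hp : p < 2 * m) (hq : q < 2 * m) (h : p ≠ q) :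
    ∃ r, r < 2 * m ∧ (Arc m (a p) (a r) ∨ Arc m (a r) (a p)) ∧
      cycleDist m r q + 1 = cycleDist m p q := by
  simp only [Arc, cycleDist]
  by_cases h1 : p < q
  · by_cases h2 : q - p ≤ m
    · exact ⟨p + 1, by omega⟩
    · by_cases h0 : p = 0
      · exact ⟨2 * m - 1, by omega⟩
      · exact ⟨p - 1, by omega⟩
  · by_cases h2 : p - q ≤ m
    · exact ⟨p - 1, by omega⟩
    · by_cases h0 : p + 1 = 2 * m
      · exact ⟨0, by omega⟩
      · exact ⟨p + 1, by omega⟩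

theorem exists_codeDist_succ {m n2 n3 : ℕ} (hm : 3 ≤ m) {x y : GCode} (hx : x.IsValid m n2 n3)
    (hy : y.IsValid m n2 n3) (h : x ≠ y) :
    ∃ x', x'.IsValid m n2 n3 ∧ (Arc m x x' ∨ Arc m x' x) ∧
      codeDist m x' y + 1 = codeDist m x y := by
  cases x with
  | a p =>
    have key : ∀ q, q < 2 * m → p ≠ q → (∃ k, ∀ r, codeDist m (a r) y = cycleDist m r q + k) →
        ∃ x', x'.IsValid m n2 n3 ∧ (Arc m (a p) x' ∨ Arc m x' (a p)) ∧
          codeDist m x' y + 1 = codeDist m (a p) y := by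
      rintro q hq hpq ⟨k, hk⟩
      obtain ⟨r, hr, harc, hd⟩ := exists_cycleDist_succ hx hq hpq
      exact ⟨a r, hr, harc, by rw [hk, hk]; omega⟩
    cases y with
    | a q => exact key q hy (by simpa using h) ⟨0, fun _ => rfl⟩
    | b t =>
      by_cases hp : p = 1
      · exact ⟨b 0, by simp only [IsValid] at *; omega, by simp [Arc, hp],
          by simp [codeDist, cycleDist, hp]⟩
      · exact key 1 (by omega) hp ⟨t + 1, fun _ => rfl⟩
    | c =>
      by_cases hp : p = 2 * m - 1
      · exact ⟨c, trivial, by simp only [Arc]; omega, by simp [codeDist, cycleDist, hp]⟩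
      · exact key (2 * m - 1) (by omega) hp ⟨1, fun _ => rfl⟩
    | i =>
      by_cases hp : p = 0
      · exact ⟨i, trivial, by simp [Arc, hp], by simp [codeDist, cycleDist, hp]⟩
      · exact key 0 (by omega) hp ⟨1, fun _ => rfl⟩
    | j t =>
      by_cases hp : p = 0
      · exact ⟨i, trivial, by simp [Arc, hp], by simp [codeDist, cycleDist, hp]⟩
      · exact key 0 (by omega) hp ⟨2, fun _ => rfl⟩
  | b t =>
    have hdown : (∀ s, y = b s → s < t) → ∃ x', x'.IsValid m n2 n3 ∧
        (Arc m (b t) x' ∨ Arc m x' (b t)) ∧ codeDist m x' y + 1 = codeDist m (b t) y := by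
      intro hlt
      by_cases ht : t = 0
      · refine ⟨a 1, by simp only [IsValid]; omega, by simp [Arc, ht], ?_⟩
        cases y <;> simp only [codeDist, cycleDist, IsValid, GCode.b.injEq] at * <;> grind
      · refine ⟨b (t - 1), by simp only [IsValid] at *; omega, by simp only [Arc]; omega, ?_⟩
        cases y <;> simp only [codeDist, cycleDist, IsValid, GCode.b.injEq] at * <;> grind
    by_cases hy' : ∀ s, y = b s → s < t
    · exact hdown hy'
    · push Not at hy'
      obtain ⟨s, rfl, hs⟩ := hy'
      have hne : t ≠ s := by simpa using h
      exact ⟨b (t + 1), by simp only [IsValid] at *; omega, by simp [Arc],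
        by simp only [codeDist]; omega⟩
  | c =>
    refine ⟨a (2 * m - 1), by simp only [IsValid]; omega, by simp only [Arc]; omega, ?_⟩
    cases y <;> simp only [codeDist, cycleDist, IsValid] at * <;> first | omega | simp at h
  | i =>
    cases y with
    | j t => exact ⟨j t, hy, by simp [Arc], by simp [codeDist]⟩
    | _ =>
      refine ⟨a 0, by simp only [IsValid]; omega, by simp [Arc], ?_⟩
      simp only [codeDist, cycleDist, IsValid] at *
      first | omega | exact absurd rfl h
  | j t =>
    refine ⟨i, trivial, by simp [Arc], ?_⟩
    cases y with
    | j s =>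
      have hne : t ≠ s := by simpa using h
      simp [codeDist, hne]
    | _ => simp only [codeDist]

end GCode

/-- Vertices of `L^ℓ_{n1,n2,n3}`: the index of the copy (starting from `0`) and a vertex of it. -/
abbrev LCode : Type := ℕ × GCode

namespace LCode

open GCode

/-- The code is that of a vertex of `L^ℓ_{2m,n2,n3}`. -/
def IsValid (m n2 n3 ℓ : ℕ) (u : LCode) : Prop :=
  u.1 < ℓ ∧ u.2.IsValid m (if u.1 = 0 then n2 else 1) (if u.1 = 0 then n3 else 2)

/-- The edges of `L^ℓ_{2m,n2,n3}`, each in one direction. -/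
def Arc (m : ℕ) (u v : LCode) : Prop :=
  (u.1 = v.1 ∧ GCode.Arc m u.2 v.2) ∨ (v.1 = u.1 + 1 ∧ u.2 = a (m - 1) ∧ v.2 = j 0)

/-- The distance in `L^ℓ_{2m,n2,n3}`. -/
def lDist (m : ℕ) (u v : LCode) : ℕ :=
  if u.1 = v.1 then codeDist m u.2 v.2
  else if u.1 < v.1 then
    codeDist m u.2 (a (m - 1)) + (v.1 - u.1 - 1) * (m + 2) + 1 + codeDist m v.2 (j 0)
  else codeDist m u.2 (j 0) + (u.1 - v.1 - 1) * (m + 2) + 1 + codeDist m v.2 (a (m - 1))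

theorem lDist_same (m k : ℕ) (x y : GCode) : lDist m (k, x) (k, y) = codeDist m x y := by
  simp [lDist]

theorem lDist_up (m k d : ℕ) (x y : GCode) : lDist m (k, x) (k + 1 + d, y) =
    codeDist m x (a (m - 1)) + d * (m + 2) + 1 + codeDist m y (j 0) := by
  have h : k + 1 + d - k - 1 = d := by omega
  simp only [lDist]
  rw [if_neg (by omega), if_pos (by omega), h]

theorem lDist_down (m k d : ℕ) (x y : GCode) : lDist m (k + 1 + d, x) (k, y) =
    codeDist m x (j 0) + d * (m + 2) + 1 + codeDist m y (a (m - 1)) := by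
  have h : k + 1 + d - k - 1 = d := by omega
  simp only [lDist]
  rw [if_neg (by omega), if_neg (by omega), h]

theorem codeDist_j_a_pred {m : ℕ} (hm : 3 ≤ m) (t : ℕ) :
    codeDist m (j t) (a (m - 1)) = m + 1 := by
  simp only [codeDist, cycleDist]; omega

theorem codeDist_a_pred_j {m : ℕ} (hm : 3 ≤ m) (t : ℕ) :
    codeDist m (a (m - 1)) (j t) = m + 1 := by
  simp only [codeDist, cycleDist]; omega

theorem IsValid.weaken {m n2 n3 ℓ : ℕ} (h2 : 1 ≤ n2) (h3 : 2 ≤ n3) {u : LCode}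
    (hu : u.IsValid m n2 n3 ℓ) : u.2.IsValid m n2 n3 := by
  obtain ⟨k, x⟩ := u
  obtain ⟨-, hu⟩ := hu
  by_cases hk : k = 0 <;> simp only [hk, if_true, if_false] at hu <;>
    cases x <;> simp only [GCode.IsValid] at * <;> omega

theorem lDist_arc {m n2 n3 ℓ : ℕ} (hm : 3 ≤ m) (h2 : 1 ≤ n2) (h3 : 2 ≤ n3) {u u' v : LCode}
    (hu : u.IsValid m n2 n3 ℓ) (hu' : u'.IsValid m n2 n3 ℓ) (hv : v.IsValid m n2 n3 ℓ)
    (h : Arc m u u') : lDist m u v ≤ lDist m u' v + 1 ∧ lDist m u' v ≤ lDist m u v + 1 := by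
  replace hu := hu.weaken h2 h3
  replace hu' := hu'.weaken h2 h3
  replace hv := hv.weaken h2 h3
  obtain ⟨k, x⟩ := u
  obtain ⟨k', x'⟩ := u'
  obtain ⟨r, y⟩ := v
  rcases h with ⟨h, harc⟩ | ⟨h, hx, hx'⟩ <;> simp only at *
  · subst h
    have ha : (a (m - 1)).IsValid m n2 n3 := by simp only [GCode.IsValid]; omega
    have hj : (j 0).IsValid m n2 n3 := by simp only [GCode.IsValid]; omega
    have e1 := codeDist_arc hm hu hu' hv harc
    have e2 := codeDist_arc hm hu hu' ha harc
    have e3 := codeDist_arc hm hu hu' hj harc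
    simp only [lDist]
    split_ifs <;> omega
  · subst h hx hx'
    have hc1 := codeDist_comm m (a (m - 1)) y
    have hc2 := codeDist_comm m (j 0) y
    rcases lt_trichotomy r k with h | rfl | h
    · obtain ⟨d, rfl⟩ := Nat.exists_eq_add_of_lt h
      rw [show r + d + 1 = r + 1 + d by omega, show r + 1 + d + 1 = r + 1 + (d + 1) by omega,
        lDist_down, lDist_down, codeDist_a_pred_j hm, codeDist_self, Nat.add_mul]
      omega
    · have := lDist_down m r 0 (j 0) y
      rw [Nat.add_zero] at this
      rw [this, lDist_same, codeDist_self]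
      omega
    · obtain ⟨d, rfl⟩ := Nat.exists_eq_add_of_lt h
      rw [show k + d + 1 = k + 1 + d by omega, lDist_up, codeDist_self]
      cases d with
      | zero => rw [Nat.add_zero, lDist_same]; omega
      | succ d =>
        rw [show k + 1 + (d + 1) = (k + 1) + 1 + d by omega, lDist_up, codeDist_j_a_pred hm,
          Nat.add_mul]
        omega

theorem exists_lDist_succ {m n2 n3 ℓ : ℕ} (hm : 3 ≤ m)
    {u v : LCode} (hu : u.IsValid m n2 n3 ℓ) (hv : v.IsValid m n2 n3 ℓ) (h : u ≠ v) :
    ∃ u' : LCode, u'.IsValid m n2 n3 ℓ ∧ (Arc m u u' ∨ Arc m u' u) ∧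
      lDist m u' v + 1 = lDist m u v := by
  obtain ⟨k, x⟩ := u
  obtain ⟨r, y⟩ := v
  have inCopy : ∀ y' : GCode, y'.IsValid m (if k = 0 then n2 else 1) (if k = 0 then n3 else 2) →
      x ≠ y' → (∃ s, ∀ x', lDist m (k, x') (r, y) = codeDist m x' y' + s) →
      ∃ u' : LCode, u'.IsValid m n2 n3 ℓ ∧ (Arc m (k, x) u' ∨ Arc m u' (k, x)) ∧
        lDist m u' (r, y) + 1 = lDist m (k, x) (r, y) := by
    rintro y' hy' hne ⟨s, hs⟩
    obtain ⟨x', hx', harc, hd⟩ := exists_codeDist_succ hm hu.2 hy' hne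
    refine ⟨(k, x'), ⟨hu.1, hx'⟩, ?_, by rw [hs, hs, ← hd, Nat.add_right_comm]⟩
    exact harc.imp (fun h => .inl ⟨rfl, h⟩) (fun h => .inl ⟨rfl, h⟩)
  rcases lt_trichotomy r k with hk | rfl | hk
  · obtain ⟨d, rfl⟩ := Nat.exists_eq_add_of_lt hk
    rw [show r + d + 1 = r + 1 + d by omega] at *
    by_cases hx : x = j 0
    · subst hx
      refine ⟨(r + d, a (m - 1)), ⟨by have : r + 1 + d < ℓ := hu.1; simp only; omega, ?_⟩,
        .inr (.inr ⟨by simp only; omega, rfl, rfl⟩), ?_⟩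
      · simp only [GCode.IsValid]; omega
      · rw [lDist_down, codeDist_self]
        cases d with
        | zero => rw [Nat.add_zero r, lDist_same, codeDist_comm]; omega
        | succ d =>
          rw [show r + (d + 1) = r + 1 + d by omega, lDist_down, codeDist_a_pred_j hm, Nat.add_mul]
          omega
    · refine inCopy (j 0) ?_ hx ⟨_, fun x' => by rw [lDist_down, Nat.add_assoc, Nat.add_assoc]⟩
      simp only [GCode.IsValid]; split <;> omega
  · refine inCopy y hv.2 (by rintro rfl; exact h rfl) ⟨0, fun x' => lDist_same ..⟩
  · obtain ⟨d, rfl⟩ := Nat.exists_eq_add_of_lt hk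
    rw [show k + d + 1 = k + 1 + d by omega] at *
    by_cases hx : x = a (m - 1)
    · subst hx
      refine ⟨(k + 1, j 0), ⟨by have : k + 1 + d < ℓ := hv.1; simp only; omega, ?_⟩,
        .inl (.inr ⟨rfl, rfl, rfl⟩), ?_⟩
      · simp only [Nat.add_eq_zero_iff, one_ne_zero, and_false, if_false, GCode.IsValid]; omega
      · rw [lDist_up, codeDist_self]
        cases d with
        | zero => rw [Nat.add_zero, lDist_same, codeDist_comm]; omega
        | succ d =>
          rw [show k + 1 + (d + 1) = k + 1 + 1 + d by omega, lDist_up, codeDist_j_a_pred hm,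
            Nat.add_mul]
          omega
    · refine inCopy (a (m - 1)) ?_ hx ⟨_, fun x' => by rw [lDist_up, Nat.add_assoc, Nat.add_assoc]⟩
      simp only [GCode.IsValid]; omega

end LCode

/-- The code of a vertex of `G_{n1,n2,n3}`. -/
def GVert.code {n1 n2 n3 : ℕ} : GVert n1 n2 n3 → GCode
  | .a p => .a p
  | .b t => .b t
  | .c => .c
  | .i => .i
  | .j t => .j t

/-- The code of a vertex of `L^ℓ_{n1,n2,n3}`. -/
def LVert.code {n1 n2 n3 ℓ : ℕ} : LVert n1 n2 n3 ℓ → LCode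
  | .inl x => (0, x.code)
  | .inr (k, x) => (k + 1, x.code)

theorem GVert.code_injective {n1 n2 n3 : ℕ} :
    (GVert.code (n1 := n1) (n2 := n2) (n3 := n3)).Injective := by
  intro x y h
  cases x <;> cases y <;> simp_all [GVert.code, Fin.ext_iff]

theorem GVert.isValid_code {m n2 n3 : ℕ} (x : GVert (2 * m) n2 n3) : x.code.IsValid m n2 n3 := by
  cases x <;> simp [GVert.code, GCode.IsValid]

theorem GVert.exists_code_eq {m n2 n3 : ℕ} {x : GCode} (hx : x.IsValid m n2 n3) :
    ∃ y : GVert (2 * m) n2 n3, y.code = x := by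
  cases x with
  | a p => exact ⟨.a ⟨p, hx⟩, rfl⟩
  | b t => exact ⟨.b ⟨t, hx⟩, rfl⟩
  | c => exact ⟨.c, rfl⟩
  | i => exact ⟨.i, rfl⟩
  | j t => exact ⟨.j ⟨t, hx⟩, rfl⟩

theorem GCode.Arc.ne {m : ℕ} {x y : GCode} (h : GCode.Arc m x y) : x ≠ y := by
  rintro rfl
  cases x <;> simp only [GCode.Arc] at h <;> omega

theorem gRel_iff {m n2 n3 : ℕ} (x y : GVert (2 * m) n2 n3) :
    GRel (2 * m) n2 n3 x y ↔ GCode.Arc m x.code y.code := by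
  cases x <;> cases y <;> simp only [GRel, GVert.code, GCode.Arc]
  case a.a p q =>
    have hp := p.isLt
    by_cases h : (p : ℕ) + 1 = 2 * m
    · rw [h, Nat.mod_self]; omega
    · rw [Nat.mod_eq_of_lt (by omega)]; omega
  case a.c p => omega

theorem gGraph_adj {m n2 n3 : ℕ} (x y : GVert (2 * m) n2 n3) :
    (GGraph (2 * m) n2 n3).Adj x y ↔ GCode.Arc m x.code y.code ∨ GCode.Arc m y.code x.code := by
  rw [GGraph, SimpleGraph.fromRel_adj, gRel_iff, gRel_iff, and_iff_right_iff_imp]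
  rintro (h | h) rfl <;> exact h.ne rfl

theorem isAlphaVert_iff {m n2 n3 : ℕ} (x : GVert (2 * m) n2 n3) :
    IsAlphaVert x ↔ x.code = .a (m - 1) := by
  cases x <;> simp only [IsAlphaVert, GVert.code, reduceCtorEq, GCode.a.injEq]
  omega

theorem isJOneVert_iff {n1 n2 n3 : ℕ} (x : GVert n1 n2 n3) :
    IsJOneVert x ↔ x.code = .j 0 := by
  cases x <;> simp [IsJOneVert, GVert.code]

section LVert

variable {m n2 n3 ℓ : ℕ}

theorem LVert.code_injective :
    (LVert.code (n1 := 2 * m) (n2 := n2) (n3 := n3) (ℓ := ℓ)).Injective := by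
  rintro (x | ⟨k, x⟩) (y | ⟨r, y⟩) h <;>
    simp only [LVert.code, Prod.mk.injEq, Nat.add_right_cancel_iff] at h
  · rw [GVert.code_injective h.2]
  · omega
  · omega
  · rw [GVert.code_injective h.2, Fin.ext h.1]

theorem LVert.isValid_code (hl : 1 ≤ ℓ) (u : LVert (2 * m) n2 n3 ℓ) :
    (LVert.code u).IsValid m n2 n3 ℓ := by
  rcases u with x | ⟨k, x⟩
  · exact ⟨hl, x.isValid_code⟩
  · exact ⟨by have := k.isLt; simp only [LVert.code]; omega, by simpa [LVert.code] using x.isValid_code⟩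

theorem LVert.exists_code_eq {u : LCode} (hu : u.IsValid m n2 n3 ℓ) :
    ∃ v : LVert (2 * m) n2 n3 ℓ, LVert.code v = u := by
  obtain ⟨_ | k, x⟩ := u
  · obtain ⟨y, rfl⟩ := GVert.exists_code_eq (show x.IsValid m n2 n3 from hu.2)
    exact ⟨.inl y, rfl⟩
  · obtain ⟨y, rfl⟩ := GVert.exists_code_eq (show x.IsValid m 1 2 from hu.2)
    exact ⟨.inr (⟨k, by have := hu.1; simp only at this; omega⟩, y), rfl⟩

theorem lGraph_adj (u v : LVert (2 * m) n2 n3 ℓ) :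
    (LGraph (2 * m) n2 n3 ℓ).Adj u v ↔
      LCode.Arc m (LVert.code u) (LVert.code v) ∨ LCode.Arc m (LVert.code v) (LVert.code u) := by
  rw [LGraph, SimpleGraph.fromRel_adj]
  rcases u with x | ⟨k, x⟩ <;> rcases v with y | ⟨r, y⟩
  · have := fun h : (GGraph (2 * m) n2 n3).Adj x y => h.ne
    simp only [LRel, LCode.Arc, LVert.code, ne_eq, Sum.inl.injEq, gGraph_adj] at *
    grind
  · simp only [LRel, LCode.Arc, LVert.code, isAlphaVert_iff, isJOneVert_iff]
    grind
  · simp only [LRel, LCode.Arc, LVert.code, isAlphaVert_iff, isJOneVert_iff]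
    grind
  · have := fun h : (GGraph (2 * m) 1 2).Adj x y => h.ne
    simp only [LRel, LCode.Arc, LVert.code, isAlphaVert_iff, isJOneVert_iff, gGraph_adj,
      Fin.ext_iff, ne_eq, Sum.inr.injEq, Prod.mk.injEq] at *
    grind

theorem lGraph_dist (hm : 3 ≤ m) (h2 : 1 ≤ n2) (h3 : 2 ≤ n3) (hl : 1 ≤ ℓ)
    (u v : LVert (2 * m) n2 n3 ℓ) :
    (LGraph (2 * m) n2 n3 ℓ).dist u v = LCode.lDist m (LVert.code u) (LVert.code v) := by
  refine SimpleGraph.dist_eq_of_potential (fun u => LCode.lDist m (LVert.code u) (LVert.code v))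
    ?_ ?_ ?_ u
  · simp [LCode.lDist, GCode.codeDist_self]
  · intro x y hxy
    have hx := LVert.isValid_code hl x
    have hy := LVert.isValid_code hl y
    have hv := LVert.isValid_code hl v
    rcases (lGraph_adj x y).1 hxy with h | h
    · exact (LCode.lDist_arc hm h2 h3 hx hy hv h).1
    · exact (LCode.lDist_arc hm h2 h3 hy hx hv h).2
  · intro x hx
    obtain ⟨y, hy, harc, hd⟩ := LCode.exists_lDist_succ hm (LVert.isValid_code hl x)
      (LVert.isValid_code hl v) (fun h => hx (LVert.code_injective h))
    obtain ⟨y, rfl⟩ := LVert.exists_code_eq hy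
    exact ⟨y, (lGraph_adj x y).2 harc, hd⟩

end LVert

namespace GCode

variable {m n2 n3 : ℕ}

/-- In a single copy, the distances to `c`, to all but one of the pendant vertices, and to `b 0`
or to the antipode of `a (2 * m - 1)` determine the vertex. -/
theorem eq_of_codeDist_eq (hm : 3 ≤ m) {e : ℕ} (he : e < 2) (h3 : 2 ≤ n3) {x y : GCode}
    (hx : x.IsValid m n2 n3) (hy : y.IsValid m n2 n3) (hc : codeDist m x c = codeDist m y c)
    (h : codeDist m x (a (m - 1)) = codeDist m y (a (m - 1)) ∨
      codeDist m x (b 0) = codeDist m y (b 0))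
    (hj : ∀ t < n3, t ≠ e → codeDist m x (j t) = codeDist m y (j t)) : x = y := by
  have hj0 := hj (1 - e) (by omega) (by omega)
  cases x <;> cases y <;>
    simp only [codeDist, cycleDist, IsValid, reduceCtorEq, GCode.a.injEq, GCode.b.injEq,
      GCode.j.injEq] at hx hy hc h hj0 ⊢ <;>
    try omega
  case j.j s t =>
    by_contra hne
    have hs := hj s hx
    have ht := hj t hy
    simp only [codeDist, if_true, hne, Ne.symm hne, if_false] at hs ht
    omega
  all_goals grind

/-- The distance from the edge joining `x` and `x'` to `z`. -/
def edgeCodeDist (m : ℕ) (x x' z : GCode) : ℕ := min (codeDist m x z) (codeDist m x' z)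

/-- The edges of `G_{2m,n2,n3}` with their distances to the pendant vertices (other than an end
of the edge), to `a (m - 1)` and to `a (m + 1)`. -/
inductive ArcProfile (m : ℕ) : GCode → GCode → ℕ → ℕ → ℕ → Prop
  | ascending (p A Z : ℕ) : p < m → (A + p + 2 = m ∨ (p + 1 = m ∧ A = 0)) →
      ((p = 0 ∧ Z + 1 = m) ∨ (0 < p ∧ Z + p = m)) → ArcProfile m (a p) (a (p + 1)) (p + 2) A Z
  | descending (p q r A Z : ℕ) : p + r + 1 = 2 * m → r < m →
      ((r = 0 ∧ q = 0) ∨ (0 < r ∧ q = p + 1)) → ((0 < r ∧ A + r = m) ∨ (r = 0 ∧ A + 1 = m)) →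
      (Z + r + 2 = m ∨ (r + 1 = m ∧ Z = 0)) → ArcProfile m (a p) (a q) (r + 2) A Z
  | ab : ArcProfile m (a 1) (b 0) 3 (m - 2) m
  | bb (s : ℕ) : ArcProfile m (b s) (b (s + 1)) (s + 4) (m + s - 1) (m + s + 1)
  | ac : ArcProfile m (a (2 * m - 1)) c 3 m (m - 2)
  | ai : ArcProfile m (a 0) i 1 (m - 1) (m - 1)
  | ij (t : ℕ) : ArcProfile m i (j t) 1 m m

theorem exists_arcProfile (hm : 3 ≤ m) {x x' : GCode} (hx : x.IsValid m n2 n3)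
    (hx' : x'.IsValid m n2 n3) (h : Arc m x x') :
    ∃ P, ArcProfile m x x' P (edgeCodeDist m x x' (a (m - 1))) (edgeCodeDist m x x' (a (m + 1))) ∧
      ∀ t, x' ≠ j t → edgeCodeDist m x x' (j t) = P := by
  cases x <;> cases x' <;> simp only [Arc] at h
  case a.a p q =>
    by_cases hp : p < m
    · obtain rfl : q = p + 1 := by simp only [IsValid] at hx hx'; omega
      refine ⟨p + 2, .ascending p _ _ hp ?_ ?_, fun t _ => ?_⟩ <;>
        simp only [edgeCodeDist, codeDist, cycleDist] <;> omega
    · simp only [IsValid] at hx hx'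
      refine ⟨2 * m - 1 - p + 2, .descending p q (2 * m - 1 - p) _ _ (by omega) (by omega)
        (by omega) ?_ ?_, fun t _ => ?_⟩ <;>
        simp only [edgeCodeDist, codeDist, cycleDist] <;> omega
  case a.b p t =>
    obtain ⟨rfl, rfl⟩ := h
    have e1 : edgeCodeDist m (a 1) (b 0) (a (m - 1)) = m - 2 := by
      simp only [edgeCodeDist, codeDist, cycleDist]; omega
    have e2 : edgeCodeDist m (a 1) (b 0) (a (m + 1)) = m := by
      simp only [edgeCodeDist, codeDist, cycleDist]; omega
    refine ⟨3, by rw [e1, e2]; exact .ab, fun t _ => ?_⟩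
    simp only [edgeCodeDist, codeDist, cycleDist]; omega
  case b.b s t =>
    subst h
    have e1 : edgeCodeDist m (b s) (b (s + 1)) (a (m - 1)) = m + s - 1 := by
      simp only [edgeCodeDist, codeDist, cycleDist]; omega
    have e2 : edgeCodeDist m (b s) (b (s + 1)) (a (m + 1)) = m + s + 1 := by
      simp only [edgeCodeDist, codeDist, cycleDist]; omega
    refine ⟨s + 4, by rw [e1, e2]; exact .bb s, fun t _ => ?_⟩
    simp only [edgeCodeDist, codeDist]; omega
  case a.c p =>
    obtain rfl : p = 2 * m - 1 := by omega
    have e1 : edgeCodeDist m (a (2 * m - 1)) c (a (m - 1)) = m := by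
      simp only [edgeCodeDist, codeDist, cycleDist]; omega
    have e2 : edgeCodeDist m (a (2 * m - 1)) c (a (m + 1)) = m - 2 := by
      simp only [edgeCodeDist, codeDist, cycleDist]; omega
    refine ⟨3, by rw [e1, e2]; exact .ac, fun t _ => ?_⟩
    simp only [edgeCodeDist, codeDist, cycleDist]; omega
  case a.i p =>
    subst h
    have e1 : edgeCodeDist m (a 0) i (a (m - 1)) = m - 1 := by
      simp only [edgeCodeDist, codeDist, cycleDist]; omega
    have e2 : edgeCodeDist m (a 0) i (a (m + 1)) = m - 1 := by
      simp only [edgeCodeDist, codeDist, cycleDist]; omega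
    refine ⟨1, by rw [e1, e2]; exact .ai, fun t _ => ?_⟩
    simp only [edgeCodeDist, codeDist, cycleDist]; omega
  case i.j s =>
    have e1 : edgeCodeDist m i (j s) (a (m - 1)) = m := by
      simp only [edgeCodeDist, codeDist, cycleDist]; omega
    have e2 : edgeCodeDist m i (j s) (a (m + 1)) = m := by
      simp only [edgeCodeDist, codeDist, cycleDist]; omega
    refine ⟨1, by rw [e1, e2]; exact .ij s, fun t ht => ?_⟩
    have hne : s ≠ t := by simpa using ht
    simp [edgeCodeDist, codeDist, hne]

theorem edgeCodeDist_end {x t : _} : edgeCodeDist m x (j t) (j t) = 0 := by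
  simp [edgeCodeDist, codeDist_self]

theorem ArcProfile.eq (hm : 3 ≤ m) {x x' y y' : GCode} {P A Z A' Z' : ℕ}
    (hx : ArcProfile m x x' P A Z) (hy : ArcProfile m y y' P A' Z') (h : A = A' ∨ Z = Z') :
    (x = y ∧ x' = y') ∨ (x = i ∧ y = i) := by
  cases hx <;> cases hy <;>
    simp only [reduceCtorEq, GCode.a.injEq, true_and, and_true, and_false, or_false, or_true] <;>
    omega

theorem ArcProfile.pos {x x' : GCode} {P A Z : ℕ} (hx : ArcProfile m x x' P A Z) : 0 < P := by
  cases hx <;> omega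

theorem Arc.eq_i_of_j {x : GCode} {t : ℕ} (h : Arc m x (j t)) : x = i := by
  cases x <;> simp [Arc] at h ⊢

theorem Arc.exists_eq_j_of_i {x : GCode} (h : Arc m i x) : ∃ t, x = j t := by
  cases x <;> simp [Arc] at h ⊢

/-- In a single copy, the distances to all but one of the pendant vertices, and to `a (m - 1)`
or `a (m + 1)`, determine the edge. -/
theorem arc_eq_of_edgeCodeDist_eq (hm : 3 ≤ m) {e : ℕ} (he : e < 2) (h3 : 2 ≤ n3)
    {x x' y y' : GCode} (hx : x.IsValid m n2 n3) (hx' : x'.IsValid m n2 n3)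
    (hy : y.IsValid m n2 n3) (hy' : y'.IsValid m n2 n3) (hxx' : Arc m x x') (hyy' : Arc m y y')
    (h : edgeCodeDist m x x' (a (m - 1)) = edgeCodeDist m y y' (a (m - 1)) ∨
      edgeCodeDist m x x' (a (m + 1)) = edgeCodeDist m y y' (a (m + 1)))
    (hj : ∀ t < n3, t ≠ e → edgeCodeDist m x x' (j t) = edgeCodeDist m y y' (j t)) :
    x = y ∧ x' = y' := by
  obtain ⟨P, hP, hPj⟩ := exists_arcProfile hm hx hx' hxx'
  obtain ⟨Q, hQ, hQj⟩ := exists_arcProfile hm hy hy' hyy'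
  have pend : ∀ t, t ≠ e → (x' = j t ↔ y' = j t) := by
    intro t ht
    constructor
    · rintro rfl
      by_contra hne
      have := hj t hx' ht
      rw [edgeCodeDist_end, hQj t hne] at this
      exact hQ.pos.ne this
    · rintro rfl
      by_contra hne
      have := hj t hy' ht
      rw [edgeCodeDist_end, hPj t hne] at this
      exact hP.pos.ne' this
  by_cases hs : ∃ t, t ≠ e ∧ x' = j t
  · obtain ⟨t, ht, rfl⟩ := hs
    obtain rfl := (pend t ht).1 rfl
    exact ⟨hxx'.eq_i_of_j.trans hyy'.eq_i_of_j.symm, rfl⟩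
  · push Not at hs
    have ht : 1 - e ≠ e := by omega
    have hPQ := hj (1 - e) (by omega) ht
    rw [hPj _ (hs _ ht), hQj _ (fun h => hs _ ht ((pend _ ht).2 h))] at hPQ
    subst hPQ
    rcases hP.eq hm hQ h with h | ⟨rfl, rfl⟩
    · exact h
    · obtain ⟨s, rfl⟩ := hxx'.exists_eq_j_of_i
      obtain ⟨t, rfl⟩ := hyy'.exists_eq_j_of_i
      refine ⟨rfl, ?_⟩
      obtain rfl : s = e := by by_contra hne; exact hs s hne rfl
      obtain rfl : t = s := by by_contra hne; exact hs t hne ((pend t hne).2 rfl)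
      rfl

end GCode

namespace GCode

variable {m n2 n3 : ℕ}

theorem codeDist_j_le (hm : 3 ≤ m) {x : GCode} (hx : x.IsValid m n2 n3) (t : ℕ) :
    codeDist m x (j t) ≤ codeDist m x (a (m - 1)) + (m + 1) := by
  cases x <;> simp only [codeDist, cycleDist, IsValid] at * <;> grind

theorem codeDist_c_le (hm : 3 ≤ m) {x : GCode} (hx : x.IsValid m n2 n3) (t : ℕ) :
    codeDist m x c ≤ codeDist m x (j t) + 4 := by
  cases x <;> simp only [codeDist, cycleDist, IsValid] at * <;> omega

theorem codeDist_a_succ_le (hm : 3 ≤ m) {x : GCode} (hx : x.IsValid m n2 n3) (t : ℕ) :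
    codeDist m x (a (m + 1)) ≤ codeDist m x (j t) + (m + 1) := by
  cases x <;> simp only [codeDist, cycleDist, IsValid] at * <;> omega

theorem codeDist_a_pred_le (hm : 3 ≤ m) {x : GCode} (hx : x.IsValid m n2 n3) (t : ℕ) :
    codeDist m x (a (m - 1)) ≤ codeDist m x (j t) + (m + 1) := by
  cases x <;> simp only [codeDist, cycleDist, IsValid] at * <;> omega

theorem codeDist_a_succ_j (hm : 3 ≤ m) (t : ℕ) : codeDist m (a (m + 1)) (j t) = m + 1 := by
  simp only [codeDist, cycleDist]; omega

end GCode

namespace LCode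

open GCode

variable {m n2 n3 ℓ : ℕ}

theorem lDist_pendant_succ (hm : 3 ≤ m) (r t : ℕ) (x : GCode) :
    lDist m (r + 1, x) (0, j t) = codeDist m x (j 0) + r * (m + 2) + (m + 2) := by
  have h := lDist_down m 0 r x (j t)
  rw [codeDist_j_a_pred hm, show 0 + 1 + r = r + 1 by omega] at h
  omega

theorem lDist_pendant_le (hm : 3 ≤ m) {x : GCode} (hx : x.IsValid m n2 n3) (k t : ℕ) :
    lDist m (k, x) (0, j t) ≤ codeDist m x (a (m - 1)) + (m + 1) + k * (m + 2) := by
  have h := fun t => codeDist_j_le hm hx t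
  cases k with
  | zero => rw [lDist_same, Nat.zero_mul]; exact h t
  | succ r =>
    have := h 0
    rw [lDist_pendant_succ hm, Nat.add_mul]
    omega

theorem eq_of_lDist_eq (hm : 3 ≤ m) (h2 : 1 ≤ n2) (h3 : 2 ≤ n3) {u v : LCode}
    (hu : u.IsValid m n2 n3 ℓ) (hv : v.IsValid m n2 n3 ℓ)
    (hj : ∀ t < n3, t ≠ 0 → lDist m u (0, j t) = lDist m v (0, j t))
    (hc : ∀ k < ℓ, lDist m u (k, c) = lDist m v (k, c))
    (hb : lDist m u (ℓ - 1, b 0) = lDist m v (ℓ - 1, b 0)) : u = v := by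
  wlog huv : u.1 ≤ v.1 generalizing u v
  · exact (this hv hu (fun t h h' => (hj t h h').symm) (fun k h => (hc k h).symm) hb.symm
      (by omega)).symm
  obtain ⟨k, x⟩ := u
  obtain ⟨r, y⟩ := v
  have hx := hu.weaken h2 h3
  have hy := hv.weaken h2 h3
  have hkl : k < ℓ := hu.1
  have hrl : r < ℓ := hv.1
  simp only at hx hy huv
  rcases huv.eq_or_lt with rfl | hlt
  · have hck := hc k hkl
    rw [lDist_same, lDist_same] at hck
    have hab : codeDist m x (a (m - 1)) = codeDist m y (a (m - 1)) ∨
        codeDist m x (b 0) = codeDist m y (b 0) := by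
      by_cases hl : k + 1 < ℓ
      · left
        have := hc (k + 1) hl
        rw [← Nat.add_zero (k + 1), lDist_up, lDist_up] at this
        omega
      · right
        rwa [show ℓ - 1 = k by omega, lDist_same, lDist_same] at hb
    cases k with
    | zero =>
      simp only [lDist_same] at hj
      exact Prod.ext rfl (eq_of_codeDist_eq hm (e := 0) (by omega) h3 hu.2 hv.2 hck hab hj)
    | succ k =>
      have hj1 := hj 1 (by omega) (by omega)
      rw [lDist_pendant_succ hm, lDist_pendant_succ hm] at hj1
      refine Prod.ext rfl (eq_of_codeDist_eq hm (e := 1) (by omega) (by simp) hu.2 hv.2 hck hab ?_)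
      intro t ht ht1
      simp only [Nat.add_eq_zero_iff, one_ne_zero, and_false, if_false] at ht
      obtain rfl : t = 0 := by omega
      exact Nat.add_right_cancel (Nat.add_right_cancel hj1)
  · obtain ⟨d, rfl⟩ := Nat.exists_eq_add_of_lt hlt
    have hj1 := hj 1 (by omega) (by omega)
    have hle := lDist_pendant_le hm hx k 1
    have hcr := hc _ hrl
    have hcy := codeDist_c_le hm hy 0
    rw [lDist_same, show k + d + 1 = k + 1 + d by omega, lDist_up,
      show codeDist m c (j 0) = 4 from rfl] at hcr
    rw [hj1, lDist_pendant_succ hm, Nat.add_mul] at hle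
    omega

/-- The distance from the edge joining `u` and `u'` to `z`. -/
def edgeLDist (m : ℕ) (u u' z : LCode) : ℕ := min (lDist m u z) (lDist m u' z)

theorem edgeLDist_same (k : ℕ) (x x' z : GCode) :
    edgeLDist m (k, x) (k, x') (k, z) = edgeCodeDist m x x' z := by
  rw [edgeLDist, lDist_same, lDist_same, edgeCodeDist]

theorem edgeLDist_pendant_succ (hm : 3 ≤ m) (r t : ℕ) (x x' : GCode) :
    edgeLDist m (r + 1, x) (r + 1, x') (0, j t) =
      edgeCodeDist m x x' (j 0) + r * (m + 2) + (m + 2) := by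
  rw [edgeLDist, lDist_pendant_succ hm, lDist_pendant_succ hm, edgeCodeDist]
  omega

theorem edgeLDist_pendant_le (hm : 3 ≤ m) {x x' : GCode} (hx : x.IsValid m n2 n3)
    (hx' : x'.IsValid m n2 n3) (k t : ℕ) : edgeLDist m (k, x) (k, x') (0, j t) ≤
      edgeCodeDist m x x' (a (m - 1)) + (m + 1) + k * (m + 2) := by
  have h1 := lDist_pendant_le hm hx k t
  have h2 := lDist_pendant_le hm hx' k t
  rw [edgeLDist, edgeCodeDist]
  omega

theorem edgeLDist_top_up (hm : 3 ≤ m) (k d : ℕ) (x x' : GCode) :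
    edgeLDist m (k, x) (k, x') (k + 1 + d, a (m + 1)) =
      edgeCodeDist m x x' (a (m - 1)) + d * (m + 2) + (m + 2) := by
  rw [edgeLDist, lDist_up, lDist_up, codeDist_a_succ_j hm, edgeCodeDist]
  omega

theorem edgeLDist_top_le (hm : 3 ≤ m) {x x' : GCode} (hx : x.IsValid m n2 n3)
    (hx' : x'.IsValid m n2 n3) (k d : ℕ) : edgeLDist m (k, x) (k, x') (k + d, a (m + 1)) ≤
      edgeCodeDist m x x' (j 0) + (m + 1) + d * (m + 2) := by
  cases d with
  | zero =>
    have h1 := codeDist_a_succ_le hm hx 0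
    have h2 := codeDist_a_succ_le hm hx' 0
    rw [Nat.add_zero, edgeLDist_same, edgeCodeDist, edgeCodeDist]
    omega
  | succ d =>
    have h1 := codeDist_a_pred_le hm hx 0
    have h2 := codeDist_a_pred_le hm hx' 0
    rw [show k + (d + 1) = k + 1 + d by omega, edgeLDist_top_up hm, edgeCodeDist, edgeCodeDist,
      Nat.add_mul]
    omega

theorem edgeLDist_link_pendant (hm : 3 ≤ m) (k t : ℕ) :
    edgeLDist m (k, a (m - 1)) (k + 1, j 0) (0, j t) = m + 1 + k * (m + 2) := by
  rw [edgeLDist, lDist_pendant_succ hm, codeDist_self]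
  cases k with
  | zero => rw [lDist_same, codeDist_a_pred_j hm]; omega
  | succ k => rw [lDist_pendant_succ hm, codeDist_a_pred_j hm, Nat.add_mul]; omega

theorem edgeLDist_link_top (hm : 3 ≤ m) (k d : ℕ) :
    edgeLDist m (k, a (m - 1)) (k + 1, j 0) (k + 1 + d, a (m + 1)) = m + 1 + d * (m + 2) := by
  rw [edgeLDist, lDist_up, codeDist_self, codeDist_a_succ_j hm]
  cases d with
  | zero => rw [Nat.add_zero, lDist_same, codeDist_comm, codeDist_a_succ_j hm]; omega
  | succ d =>
    rw [show k + 1 + (d + 1) = k + 1 + 1 + d by omega, lDist_up, codeDist_a_succ_j hm,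
      codeDist_j_a_pred hm, Nat.add_mul]
    omega

theorem link_ne_inner (hm : 3 ≤ m) {k r : ℕ} {x x' : GCode} (hk : k + 1 < ℓ) (hr : r < ℓ)
    (hx : x.IsValid m n2 n3) (hx' : x'.IsValid m n2 n3)
    (hj : edgeLDist m (k, a (m - 1)) (k + 1, j 0) (0, j 1) =
      edgeLDist m (r, x) (r, x') (0, j 1))
    (hz : edgeLDist m (k, a (m - 1)) (k + 1, j 0) (ℓ - 1, a (m + 1)) =
      edgeLDist m (r, x) (r, x') (ℓ - 1, a (m + 1))) : False := by
  obtain ⟨d, rfl⟩ := Nat.exists_eq_add_of_lt hk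
  rw [show k + 1 + d + 1 - 1 = k + 1 + d by omega] at hz
  rw [edgeLDist_link_pendant hm] at hj
  rw [edgeLDist_link_top hm] at hz
  rcases lt_or_ge k r with hkr | hkr
  · obtain ⟨s, rfl⟩ := Nat.exists_eq_add_of_lt hkr
    rw [edgeLDist_pendant_succ hm, Nat.add_mul] at hj
    omega
  · obtain ⟨s, rfl⟩ := Nat.exists_eq_add_of_le hkr
    have hle := edgeLDist_pendant_le hm hx hx' r 1
    rw [show r + s + 1 + d = r + 1 + (s + d) by omega, edgeLDist_top_up hm, Nat.add_mul] at hz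
    rw [← hj, Nat.add_mul] at hle
    omega

theorem arc_eq_of_edgeLDist_eq (hm : 3 ≤ m) (h2 : 1 ≤ n2) (h3 : 2 ≤ n3) {u u' v v' : LCode}
    (hu : u.IsValid m n2 n3 ℓ) (hu' : u'.IsValid m n2 n3 ℓ) (hv : v.IsValid m n2 n3 ℓ)
    (hv' : v'.IsValid m n2 n3 ℓ) (huu' : Arc m u u') (hvv' : Arc m v v')
    (hj : ∀ t < n3, t ≠ 0 → edgeLDist m u u' (0, j t) = edgeLDist m v v' (0, j t))
    (hz : edgeLDist m u u' (ℓ - 1, a (m + 1)) = edgeLDist m v v' (ℓ - 1, a (m + 1))) :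
    u = v ∧ u' = v' := by
  wlog huv : u.1 ≤ v.1 generalizing u u' v v'
  · have := this hv hv' hu hu' hvv' huu' (fun t h h' => (hj t h h').symm) hz.symm (by omega)
    exact ⟨this.1.symm, this.2.symm⟩
  obtain ⟨k, x⟩ := u
  obtain ⟨k', x'⟩ := u'
  obtain ⟨r, y⟩ := v
  obtain ⟨r', y'⟩ := v'
  have hx := hu.weaken h2 h3
  have hx' := hu'.weaken h2 h3
  have hy := hv.weaken h2 h3
  have hy' := hv'.weaken h2 h3
  have hkl : k < ℓ := hu.1
  have hkl' : k' < ℓ := hu'.1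
  have hrl : r < ℓ := hv.1
  have hrl' : r' < ℓ := hv'.1
  have hj1 := hj 1 (by omega) (by omega)
  simp only at hx hx' hy hy' huv
  rcases huu' with ⟨hk, hxx'⟩ | ⟨hk, rfl, rfl⟩ <;> rcases hvv' with ⟨hr, hyy'⟩ | ⟨hr, rfl, rfl⟩ <;>
    simp only at hk hr <;> subst hk hr
  · simp only at hxx' hyy'
    rcases huv.eq_or_lt with rfl | hlt
    · have hab : edgeCodeDist m x x' (a (m - 1)) = edgeCodeDist m y y' (a (m - 1)) ∨
          edgeCodeDist m x x' (a (m + 1)) = edgeCodeDist m y y' (a (m + 1)) := by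
        by_cases hl : k + 1 < ℓ
        · left
          obtain ⟨d, rfl⟩ := Nat.exists_eq_add_of_lt hl
          rw [show k + 1 + d + 1 - 1 = k + 1 + d by omega, edgeLDist_top_up hm,
            edgeLDist_top_up hm] at hz
          omega
        · right
          rwa [show ℓ - 1 = k by omega, edgeLDist_same, edgeLDist_same] at hz
      cases k with
      | zero =>
        simp only [edgeLDist_same] at hj
        have := arc_eq_of_edgeCodeDist_eq hm (e := 0) (by omega) h3 hu.2 hu'.2 hv.2 hv'.2
          hxx' hyy' hab hj
        exact ⟨Prod.ext rfl this.1, Prod.ext rfl this.2⟩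
      | succ k =>
        rw [edgeLDist_pendant_succ hm, edgeLDist_pendant_succ hm] at hj1
        have := arc_eq_of_edgeCodeDist_eq hm (e := 1) (by omega) (by simp) hu.2 hu'.2 hv.2 hv'.2
          hxx' hyy' hab ?_
        · exact ⟨Prod.ext rfl this.1, Prod.ext rfl this.2⟩
        · intro t ht ht1
          simp only [Nat.add_eq_zero_iff, one_ne_zero, and_false, if_false] at ht
          obtain rfl : t = 0 := by omega
          exact Nat.add_right_cancel (Nat.add_right_cancel hj1)
    · exfalso
      obtain ⟨d, rfl⟩ := Nat.exists_eq_add_of_lt hlt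
      obtain ⟨s, rfl⟩ := Nat.exists_eq_add_of_lt hrl
      have hle := edgeLDist_pendant_le hm hx hx' k 1
      have hle' := edgeLDist_top_le hm hy hy' (k + d + 1) s
      rw [show k + d + 1 + s + 1 - 1 = k + 1 + (d + s) by omega, edgeLDist_top_up hm] at hz
      rw [show k + d + 1 + s = k + 1 + (d + s) by omega, ← hz, Nat.add_mul] at hle'
      rw [hj1, edgeLDist_pendant_succ hm, Nat.add_mul] at hle
      omega
  · exact (link_ne_inner hm hrl' hkl hx hx' hj1.symm hz.symm).elim
  · exact (link_ne_inner hm hkl' hrl hy hy' hj1 hz).elim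
  · rw [edgeLDist_link_pendant hm, edgeLDist_link_pendant hm] at hj1
    obtain rfl : k = r := Nat.eq_of_mul_eq_mul_right (by omega) (Nat.add_left_cancel hj1)
    exact ⟨rfl, rfl⟩

end LCode

namespace GCode

/-- The code is not that of `i` or of a pendant vertex adjacent to `i`. -/
def IsCore : GCode → Prop
  | a _ => True
  | b _ => True
  | c => True
  | i => False
  | j _ => False

/-- No core vertex distinguishes all pairs of core vertices that are equidistant to `i`. -/
theorem exists_ne_codeDist_eq {m n2 n3 : ℕ} (hm : 3 ≤ m) (h2 : 1 ≤ n2) {w : GCode}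
    (hw : w.IsValid m n2 n3) (hcore : w.IsCore) :
    ∃ x y : GCode, x.IsValid m n2 n3 ∧ y.IsValid m n2 n3 ∧ x ≠ y ∧
      codeDist m x w = codeDist m y w ∧
      ∀ z : GCode, ¬ z.IsCore → codeDist m x z = codeDist m y z := by
  by_contra! hcon
  have aux : ∀ x y : GCode, x.IsValid m n2 n3 → y.IsValid m n2 n3 → x ≠ y →
      codeDist m x i = codeDist m y i → (∀ t, codeDist m x (j t) = codeDist m y (j t)) →
      codeDist m x w ≠ codeDist m y w := by
    intro x y hx hy hne hi hj hxy
    obtain ⟨z, hz, hz'⟩ := hcon x y hx hy hne hxy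
    cases z <;> simp only [IsCore, not_true_eq_false] at hz
    · exact hz' hi
    · exact hz' (hj _)
  have e1 := aux (a 1) (a (2 * m - 1)) (by simp only [IsValid]; omega)
    (by simp only [IsValid]; omega) (by simp only [ne_eq, GCode.a.injEq]; omega)
    (by simp only [codeDist, cycleDist]; omega) (by simp only [codeDist, cycleDist]; omega)
  have e2 := aux (a 2) (b 0) (by simp only [IsValid]; omega) h2 (by simp)
    (by simp only [codeDist, cycleDist]; omega) (by simp only [codeDist, cycleDist]; omega)
  have e3 := aux (a (2 * m - 2)) c (by simp only [IsValid]; omega) trivial (by simp)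
    (by simp only [codeDist, cycleDist]; omega) (by simp only [codeDist, cycleDist]; omega)
  have e4 := aux (a (2 * m - 2)) (b 0) (by simp only [IsValid]; omega) h2 (by simp)
    (by simp only [codeDist, cycleDist]; omega) (by simp only [codeDist, cycleDist]; omega)
  have e5 := aux (a 2) c (by simp only [IsValid]; omega) trivial (by simp)
    (by simp only [codeDist, cycleDist]; omega) (by simp only [codeDist, cycleDist]; omega)
  cases w <;> simp only [IsCore] at hcore <;>
    simp only [codeDist, cycleDist, IsValid] at hw e1 e2 e3 e4 e5 <;> omega

end GCode

namespace LCode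

open GCode

variable {m n2 n3 ℓ : ℕ}

theorem lDist_b_zero_eq (hm : 3 ≤ m) {k : ℕ} {z : LCode} (hz : z.1 = k → ¬ z.2.IsCore) :
    lDist m (k, b 0) z = lDist m (k, a (2 * m - 2)) z := by
  obtain ⟨r, y⟩ := z
  have e1 : codeDist m (a (2 * m - 2)) (j 0) = 4 := by simp only [codeDist, cycleDist]; omega
  have e2 : codeDist m (a (2 * m - 2)) i = 3 := by simp only [codeDist, cycleDist]; omega
  have e3 : codeDist m (b 0) (a (m - 1)) = codeDist m (a (2 * m - 2)) (a (m - 1)) := by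
    simp only [codeDist, cycleDist]; omega
  have e4 : codeDist m (b 0) (j 0) = 4 := rfl
  rcases lt_trichotomy r k with h | rfl | h
  · obtain ⟨d, rfl⟩ := Nat.exists_eq_add_of_lt h
    rw [show r + d + 1 = r + 1 + d by omega, lDist_down, lDist_down, e1, e4]
  · rw [lDist_same, lDist_same]
    cases y <;> simp only [IsCore, not_true_eq_false, imp_false] at hz
    case i => rw [e2]; rfl
    case j t => exact e1.symm
  · obtain ⟨d, rfl⟩ := Nat.exists_eq_add_of_lt h
    rw [show k + d + 1 = k + 1 + d by omega, lDist_up, lDist_up, e3]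

theorem lDist_j_eq {s t : ℕ} {z : LCode} (hs : z ≠ (0, j s)) (ht : z ≠ (0, j t)) :
    lDist m (0, j s) z = lDist m (0, j t) z := by
  obtain ⟨_ | r, y⟩ := z
  · rw [lDist_same, lDist_same]
    cases y <;> simp only [codeDist]
    case j p =>
      rw [if_neg (by rintro rfl; exact hs rfl), if_neg (by rintro rfl; exact ht rfl)]
  · rw [show r + 1 = 0 + 1 + r by omega, lDist_up, lDist_up]
    rfl

theorem edgeLDist_a_zero_pendant (hm : 3 ≤ m) (t : ℕ) :
    edgeLDist m (0, a 0) (0, a 1) (0, j t) =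
      edgeLDist m (0, a (2 * m - 1)) (0, a 0) (0, j t) := by
  simp only [edgeLDist_same, edgeCodeDist, codeDist, cycleDist]
  omega

end LCode

section Generators

open GCode LCode

variable {m n2 n3 ℓ : ℕ}

theorem IsMetricGenerator.exists_lDist_ne (hm : 3 ≤ m) (h2 : 1 ≤ n2) (h3 : 2 ≤ n3) (hl : 1 ≤ ℓ)
    {S : Set (LVert (2 * m) n2 n3 ℓ)} (hS : IsMetricGenerator (LGraph (2 * m) n2 n3 ℓ) S)
    {u v : LCode} (hu : u.IsValid m n2 n3 ℓ) (hv : v.IsValid m n2 n3 ℓ) (h : u ≠ v) :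
    ∃ z ∈ S, lDist m u (LVert.code z) ≠ lDist m v (LVert.code z) := by
  obtain ⟨u, rfl⟩ := LVert.exists_code_eq hu
  obtain ⟨v, rfl⟩ := LVert.exists_code_eq hv
  obtain ⟨z, hz, hne⟩ := hS u v (fun h' => h (congrArg _ h'))
  rw [lGraph_dist hm h2 h3 hl, lGraph_dist hm h2 h3 hl] at hne
  exact ⟨z, hz, hne⟩

theorem edgeDist_lGraph (hm : 3 ≤ m) (h2 : 1 ≤ n2) (h3 : 2 ≤ n3) (hl : 1 ≤ ℓ)
    (u v z : LVert (2 * m) n2 n3 ℓ) : edgeDist (LGraph (2 * m) n2 n3 ℓ) s(u, v) z =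
      edgeLDist m (LVert.code u) (LVert.code v) (LVert.code z) := by
  rw [edgeLDist, ← lGraph_dist hm h2 h3 hl, ← lGraph_dist hm h2 h3 hl]
  rfl

theorem IsEdgeMetricGenerator.exists_edgeLDist_ne (hm : 3 ≤ m) (h2 : 1 ≤ n2) (h3 : 2 ≤ n3)
    (hl : 1 ≤ ℓ) {S : Set (LVert (2 * m) n2 n3 ℓ)}
    (hS : IsEdgeMetricGenerator (LGraph (2 * m) n2 n3 ℓ) S) {u u' v v' : LCode}
    (hu : u.IsValid m n2 n3 ℓ) (hu' : u'.IsValid m n2 n3 ℓ) (hv : v.IsValid m n2 n3 ℓ)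
    (hv' : v'.IsValid m n2 n3 ℓ) (huu' : LCode.Arc m u u') (hvv' : LCode.Arc m v v')
    (h : s(u, u') ≠ s(v, v')) :
    ∃ z ∈ S, edgeLDist m u u' (LVert.code z) ≠ edgeLDist m v v' (LVert.code z) := by
  obtain ⟨u, rfl⟩ := LVert.exists_code_eq hu
  obtain ⟨v, rfl⟩ := LVert.exists_code_eq hv
  obtain ⟨u', rfl⟩ := LVert.exists_code_eq hu'
  obtain ⟨v', rfl⟩ := LVert.exists_code_eq hv'
  obtain ⟨z, hz, hne⟩ := hS s(u, u') ((lGraph_adj u u').2 (.inl huu')) s(v, v')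
    ((lGraph_adj v v').2 (.inl hvv')) (fun e => h (congrArg (Sym2.map LVert.code) e))
  rw [edgeDist_lGraph hm h2 h3 hl, edgeDist_lGraph hm h2 h3 hl] at hne
  exact ⟨z, hz, hne⟩

theorem isMetricGenerator_preimage_code (hm : 3 ≤ m) (h2 : 1 ≤ n2) (h3 : 2 ≤ n3) (hl : 1 ≤ ℓ)
    {T : Set LCode} (hj : ∀ t < n3, t ≠ 0 → (0, j t) ∈ T) (hc : ∀ k < ℓ, (k, c) ∈ T)
    (hb : (ℓ - 1, b 0) ∈ T) : IsMetricGenerator (LGraph (2 * m) n2 n3 ℓ) (LVert.code ⁻¹' T) := by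
  intro u v huv
  by_contra! hcon
  have key : ∀ z : LCode, z.IsValid m n2 n3 ℓ → z ∈ T →
      lDist m (LVert.code u) z = lDist m (LVert.code v) z := by
    intro z hz hzT
    obtain ⟨z, rfl⟩ := LVert.exists_code_eq hz
    rw [← lGraph_dist hm h2 h3 hl, ← lGraph_dist hm h2 h3 hl]
    exact hcon z hzT
  refine huv (LVert.code_injective (eq_of_lDist_eq hm h2 h3 (LVert.isValid_code hl u)
    (LVert.isValid_code hl v) (fun t ht ht' => key _ ⟨hl, ht⟩ (hj t ht ht'))
    (fun k hk => key _ ⟨hk, trivial⟩ (hc k hk)) (key _ ⟨by simp only; omega, ?_⟩ hb)))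
  simp only [GCode.IsValid]
  split <;> omega

theorem isEdgeMetricGenerator_preimage_code (hm : 3 ≤ m) (h2 : 1 ≤ n2) (h3 : 2 ≤ n3) (hl : 1 ≤ ℓ)
    {T : Set LCode} (hj : ∀ t < n3, t ≠ 0 → (0, j t) ∈ T) (ha : (ℓ - 1, a (m + 1)) ∈ T) :
    IsEdgeMetricGenerator (LGraph (2 * m) n2 n3 ℓ) (LVert.code ⁻¹' T) := by
  have arc : ∀ e ∈ (LGraph (2 * m) n2 n3 ℓ).edgeSet, ∃ u u' : LVert (2 * m) n2 n3 ℓ,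
      e = s(u, u') ∧ LCode.Arc m (LVert.code u) (LVert.code u') := by
    intro e
    induction e with
    | h u u' =>
      intro he
      rcases (lGraph_adj u u').1 he with h | h
      · exact ⟨u, u', rfl, h⟩
      · exact ⟨u', u, Sym2.eq_swap, h⟩
  intro e he f hf hef
  obtain ⟨u, u', rfl, hu⟩ := arc e he
  obtain ⟨v, v', rfl, hv⟩ := arc f hf
  by_contra! hcon
  have key : ∀ z : LCode, z.IsValid m n2 n3 ℓ → z ∈ T →
      edgeLDist m (LVert.code u) (LVert.code u') z =
        edgeLDist m (LVert.code v) (LVert.code v') z := by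
    intro z hz hzT
    obtain ⟨z, rfl⟩ := LVert.exists_code_eq hz
    rw [← edgeDist_lGraph hm h2 h3 hl, ← edgeDist_lGraph hm h2 h3 hl]
    exact hcon z hzT
  have := arc_eq_of_edgeLDist_eq hm h2 h3 (LVert.isValid_code hl u) (LVert.isValid_code hl u')
    (LVert.isValid_code hl v) (LVert.isValid_code hl v') hu hv
    (fun t ht ht' => key _ ⟨hl, ht⟩ (hj t ht ht'))
    (key _ ⟨by simp only; omega, by simp only [GCode.IsValid]; omega⟩ ha)
  exact hef (by rw [LVert.code_injective this.1, LVert.code_injective this.2])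

theorem pred_le_card_filter {n : ℕ} (p : ℕ → Prop) [DecidablePred p]
    (h : ∀ s < n, ∀ t < n, s ≠ t → p s ∨ p t) : n - 1 ≤ ((Finset.range n).filter p).card := by
  have h1 := Finset.card_filter_add_card_filter_not (s := Finset.range n) p
  have h2 : ((Finset.range n).filter (fun t => ¬ p t)).card ≤ 1 := by
    refine Finset.card_le_one.2 fun s hs t ht => ?_
    simp only [Finset.mem_filter, Finset.mem_range] at hs ht
    by_contra hne
    exact (h s hs.1 t ht.1 hne).elim hs.2 ht.2
  rw [Finset.card_range] at h1
  omega

theorem IsMetricGenerator.le_ncard (hm : 3 ≤ m) (h2 : 1 ≤ n2) (h3 : 2 ≤ n3) (hl : 1 ≤ ℓ)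
    {S : Set (LVert (2 * m) n2 n3 ℓ)} (hfin : S.Finite)
    (hS : IsMetricGenerator (LGraph (2 * m) n2 n3 ℓ) S) : n3 + ℓ ≤ S.ncard := by
  classical
  set T : Set LCode := LVert.code '' S
  have hTfin : T.Finite := hfin.image _
  have hcard : T.ncard = S.ncard := Set.ncard_image_of_injective S LVert.code_injective
  have hres : ∀ {u v : LCode}, u.IsValid m n2 n3 ℓ → v.IsValid m n2 n3 ℓ → u ≠ v →
      ∃ z ∈ T, z.IsValid m n2 n3 ℓ ∧ lDist m u z ≠ lDist m v z := by
    intro u v hu hv h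
    obtain ⟨z, hz, hne⟩ := hS.exists_lDist_ne hm h2 h3 hl hu hv h
    exact ⟨_, ⟨z, hz, rfl⟩, LVert.isValid_code hl z, hne⟩
  have hpend : ∀ s < n3, ∀ t < n3, s ≠ t → ((0, j s) : LCode) ∈ T ∨ ((0, j t) : LCode) ∈ T := by
    intro s hs t ht hst
    by_contra! hcon
    obtain ⟨z, hz, -, hne⟩ := hres (u := (0, j s)) (v := (0, j t)) ⟨hl, hs⟩ ⟨hl, ht⟩ (by simpa)
    exact hne (lDist_j_eq (by rintro rfl; exact hcon.1 hz) (by rintro rfl; exact hcon.2 hz))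
  have hcore : ∀ k < ℓ, ∃ w : GCode, (k, w) ∈ T ∧ w.IsCore := by
    intro k hk
    by_contra! hcon
    obtain ⟨⟨r, w⟩, hz, -, hne⟩ := hres (u := (k, b 0)) (v := (k, a (2 * m - 2)))
      ⟨hk, by simp only [GCode.IsValid]; split <;> omega⟩
      ⟨hk, by simp only [GCode.IsValid]; omega⟩ (by simp)
    exact hne (lDist_b_zero_eq hm (by rintro rfl; exact hcon w hz))
  have : Nonempty GCode := ⟨c⟩
  choose! w hwT hwC using hcore
  have hlast : ∃ w', ((ℓ - 1, w') : LCode) ∈ T ∧ w'.IsCore ∧ w' ≠ w (ℓ - 1) := by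
    by_contra! hcon
    have hl1 : ℓ - 1 < ℓ := by omega
    have hwv : (w (ℓ - 1)).IsValid m (if ℓ - 1 = 0 then n2 else 1) (if ℓ - 1 = 0 then n3 else 2) := by
      obtain ⟨z, -, hz⟩ := hwT _ hl1
      have := (LVert.isValid_code hl z).2
      rwa [hz] at this
    obtain ⟨x, y, hx, hy, hne, heq, hz⟩ :=
      exists_ne_codeDist_eq hm (by split <;> omega) hwv (hwC _ hl1)
    obtain ⟨⟨r, z⟩, hzT, hzv, hzne⟩ := hres (u := (ℓ - 1, x)) (v := (ℓ - 1, y)) ⟨hl1, hx⟩ ⟨hl1, hy⟩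
      (by simpa)
    have hr : r < ℓ := hzv.1
    by_cases hr' : r = ℓ - 1
    · subst hr'
      rw [lDist_same, lDist_same] at hzne
      by_cases hzc : z.IsCore
      · rw [hcon z hzT hzc] at hzne
        exact hzne heq
      · exact hzne (hz z hzc)
    · obtain ⟨d, hd⟩ := Nat.exists_eq_add_of_lt (show r < ℓ - 1 by omega)
      rw [hd, show r + d + 1 = r + 1 + d by omega, lDist_down, lDist_down, hz (j 0) id] at hzne
      exact hzne rfl
  obtain ⟨w', hwT', hwC', hne⟩ := hlast
  let P : Finset ℕ := (Finset.range n3).filter fun t => ((0, j t) : LCode) ∈ T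
  have hP : n3 - 1 ≤ P.card := pred_le_card_filter _ hpend
  let A : Finset LCode := P.image fun t => (0, j t)
  let B : Finset LCode := (Finset.range ℓ).image fun k => (k, w k)
  have hA : A.card = P.card := Finset.card_image_of_injective _ fun s t h => by simpa using h
  have hB : B.card = ℓ := by
    rw [Finset.card_image_of_injective _ fun s t h => (Prod.ext_iff.1 h).1, Finset.card_range]
  have hw' : (ℓ - 1, w') ∉ B := by
    simp only [B, Finset.mem_image, Prod.mk.injEq, not_exists, not_and]
    rintro k - rfl rfl
    exact hne rfl
  have hdisj : Disjoint A (insert (ℓ - 1, w') B) := by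
    rw [Finset.disjoint_left]
    intro z hzA hzB
    obtain ⟨t, -, rfl⟩ := Finset.mem_image.1 hzA
    rcases Finset.mem_insert.1 hzB with h | h
    · have e : j t = w' := (Prod.ext_iff.1 h).2
      rw [← e] at hwC'
      exact hwC'
    · obtain ⟨k, hk, h⟩ := Finset.mem_image.1 h
      have hwk := hwC k (Finset.mem_range.1 hk)
      have e : w k = j t := (Prod.ext_iff.1 h).2
      rw [e] at hwk
      exact hwk
  have hsub : ((A ∪ insert (ℓ - 1, w') B : Finset LCode) : Set LCode) ⊆ T := by
    intro z hz
    simp only [Finset.coe_union, Finset.coe_insert, Set.mem_union, Set.mem_insert_iff,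
      Finset.mem_coe, A, B, P, Finset.mem_image, Finset.mem_filter, Finset.mem_range] at hz
    rcases hz with ⟨t, ht, rfl⟩ | rfl | ⟨k, hk, rfl⟩
    · exact ht.2
    · exact hwT'
    · exact hwT k hk
  have hle := Set.ncard_le_ncard hsub hTfin
  rw [Set.ncard_coe_finset, Finset.card_union_of_disjoint hdisj, Finset.card_insert_of_notMem hw',
    hA, hB] at hle
  omega

theorem IsEdgeMetricGenerator.le_ncard (hm : 3 ≤ m) (h2 : 1 ≤ n2) (h3 : 2 ≤ n3) (hl : 1 ≤ ℓ)
    {S : Set (LVert (2 * m) n2 n3 ℓ)} (hfin : S.Finite)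
    (hS : IsEdgeMetricGenerator (LGraph (2 * m) n2 n3 ℓ) S) : n3 ≤ S.ncard := by
  classical
  set T : Set LCode := LVert.code '' S
  have hTfin : T.Finite := hfin.image _
  have hcard : T.ncard = S.ncard := Set.ncard_image_of_injective S LVert.code_injective
  have hpend : ∀ s < n3, ∀ t < n3, s ≠ t → ((0, j s) : LCode) ∈ T ∨ ((0, j t) : LCode) ∈ T := by
    intro s hs t ht hst
    by_contra! hcon
    obtain ⟨z, hz, hne⟩ := hS.exists_edgeLDist_ne hm h2 h3 hl (u := (0, i)) (v := (0, i))
      (u' := (0, j s)) (v' := (0, j t))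
      ⟨hl, trivial⟩ ⟨hl, hs⟩ ⟨hl, trivial⟩ ⟨hl, ht⟩ (.inl ⟨rfl, trivial⟩) (.inl ⟨rfl, trivial⟩)
      (by simpa)
    refine hne ?_
    rw [edgeLDist, edgeLDist, lDist_j_eq (s := s) (t := t)]
    · rintro h; exact hcon.1 ⟨z, hz, h⟩
    · rintro h; exact hcon.2 ⟨z, hz, h⟩
  have hother : ∃ z ∈ T, ∀ t, z ≠ (0, j t) := by
    by_contra! hcon
    obtain ⟨z, hz, hne⟩ := hS.exists_edgeLDist_ne hm h2 h3 hl (u := (0, a 0)) (u' := (0, a 1))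
      (v := (0, a (2 * m - 1))) (v' := (0, a 0))
      ⟨hl, by simp only [GCode.IsValid]; omega⟩ ⟨hl, by simp only [GCode.IsValid]; omega⟩
      ⟨hl, by simp only [GCode.IsValid]; omega⟩ ⟨hl, by simp only [GCode.IsValid]; omega⟩
      (.inl ⟨rfl, .inl rfl⟩) (.inl ⟨rfl, .inr ⟨by omega, rfl⟩⟩)
      (by simp only [ne_eq, Sym2.eq_iff, Prod.mk.injEq, GCode.a.injEq]; omega)
    obtain ⟨t, ht⟩ := hcon _ ⟨z, hz, rfl⟩
    rw [ht] at hne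
    exact hne (edgeLDist_a_zero_pendant hm t)
  obtain ⟨z, hzT, hz⟩ := hother
  let P : Finset ℕ := (Finset.range n3).filter fun t => ((0, j t) : LCode) ∈ T
  have hP : n3 - 1 ≤ P.card := pred_le_card_filter _ hpend
  let A : Finset LCode := P.image fun t => (0, j t)
  have hA : A.card = P.card := Finset.card_image_of_injective _ fun s t h => by simpa using h
  have hzA : z ∉ A := by
    intro h
    obtain ⟨t, -, rfl⟩ := Finset.mem_image.1 h
    exact hz t rfl
  have hsub : ((insert z A : Finset LCode) : Set LCode) ⊆ T := by
    intro y hy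
    rcases Finset.mem_insert.1 hy with rfl | hy
    · exact hzT
    · obtain ⟨t, ht, rfl⟩ := Finset.mem_image.1 hy
      exact (Finset.mem_filter.1 ht).2
  have hle := Set.ncard_le_ncard hsub hTfin
  rw [Set.ncard_coe_finset, Finset.card_insert_of_notMem hzA, hA] at hle
  omega

theorem finite_and_ncard_preimage_code_le (T : Finset LCode) :
    ((LVert.code : LVert (2 * m) n2 n3 ℓ → LCode) ⁻¹' T).Finite ∧
      ((LVert.code : LVert (2 * m) n2 n3 ℓ → LCode) ⁻¹' T).ncard ≤ T.card := by
  refine ⟨T.finite_toSet.preimage LVert.code_injective.injOn, ?_⟩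
  rw [← Set.ncard_coe_finset]
  exact Set.ncard_le_ncard_of_injOn LVert.code (fun _ h => h) LVert.code_injective.injOn
    T.finite_toSet

theorem sInf_ncard_eq {V : Type*} {p : Set V → Prop} {n : ℕ}
    (hex : ∃ S : Set V, S.Finite ∧ p S ∧ S.ncard ≤ n)
    (hle : ∀ S : Set V, S.Finite → p S → n ≤ S.ncard) :
    sInf {k | ∃ S : Set V, S.Finite ∧ p S ∧ S.ncard = k} = n := by
  obtain ⟨S, hfin, hp, hn⟩ := hex
  have hmem : S.ncard ∈ {k | ∃ S : Set V, S.Finite ∧ p S ∧ S.ncard = k} := ⟨S, hfin, hp, rfl⟩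
  refine le_antisymm ((Nat.sInf_le hmem).trans hn) (le_csInf ⟨_, hmem⟩ ?_)
  rintro k ⟨S', hfin', hp', rfl⟩
  exact hle S' hfin' hp'

theorem card_image_pendant_le (n : ℕ) [DecidableEq LCode] :
    ((Finset.Ico 1 n).image fun t => ((0, j t) : LCode)).card ≤ n - 1 :=
  Finset.card_image_le.trans (by simp)

theorem metricDim_lGraph (hm : 3 ≤ m) (h2 : 1 ≤ n2) (h3 : 2 ≤ n3) (hl : 1 ≤ ℓ) :
    metricDim (LGraph (2 * m) n2 n3 ℓ) = n3 + ℓ := by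
  classical
  refine sInf_ncard_eq ?_ fun S hfin hS => hS.le_ncard hm h2 h3 hl hfin
  let A : Finset LCode := (Finset.Ico 1 n3).image fun t => (0, j t)
  let B : Finset LCode := (Finset.range ℓ).image fun k => (k, c)
  obtain ⟨hfin, hcard⟩ := finite_and_ncard_preimage_code_le (m := m) (n2 := n2) (n3 := n3) (ℓ := ℓ)
    (insert (ℓ - 1, b 0) (A ∪ B))
  refine ⟨_, hfin, isMetricGenerator_preimage_code hm h2 h3 hl ?_ ?_ ?_, hcard.trans ?_⟩
  · intro t ht ht0
    simp [A, ht]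
    omega
  · intro k hk
    simp [B, hk]
  · simp
  · have h1 := Finset.card_insert_le (ℓ - 1, b 0) (A ∪ B)
    have h2 := Finset.card_union_le A B
    have h3 : A.card ≤ n3 - 1 := card_image_pendant_le n3
    have h4 : B.card ≤ ℓ := Finset.card_image_le.trans (by simp)
    omega

theorem edgeMetricDim_lGraph (hm : 3 ≤ m) (h2 : 1 ≤ n2) (h3 : 2 ≤ n3) (hl : 1 ≤ ℓ) :
    edgeMetricDim (LGraph (2 * m) n2 n3 ℓ) = n3 := by
  classical
  refine sInf_ncard_eq ?_ fun S hfin hS => hS.le_ncard hm h2 h3 hl hfin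
  let A : Finset LCode := (Finset.Ico 1 n3).image fun t => (0, j t)
  obtain ⟨hfin, hcard⟩ := finite_and_ncard_preimage_code_le (m := m) (n2 := n2) (n3 := n3) (ℓ := ℓ)
    (insert (ℓ - 1, a (m + 1)) A)
  refine ⟨_, hfin, isEdgeMetricGenerator_preimage_code hm h2 h3 hl ?_ ?_, hcard.trans ?_⟩
  · intro t ht ht0
    simp [A, ht]
    omega
  · simp
  · have h1 := Finset.card_insert_le (ℓ - 1, a (m + 1)) A
    have h3 : A.card ≤ n3 - 1 := card_image_pendant_le n3
    omega

end Generators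

/-- Lemma 6 (even case): if `n1` is even then `dim(L^ℓ_{n1,n2,n3}) = n3 + ℓ` and
`edim(L^ℓ_{n1,n2,n3}) = n3`. -/
theorem LGraph_even (n1 n2 n3 ℓ : ℕ) (h1 : 5 ≤ n1) (heven : Even n1)
    (h2 : 1 ≤ n2) (h3 : 2 ≤ n3) (hl : 1 ≤ ℓ) :
    metricDim (LGraph n1 n2 n3 ℓ) = n3 + ℓ ∧
    edgeMetricDim (LGraph n1 n2 n3 ℓ) = n3 := by
  obtain ⟨m, rfl⟩ := heven.exists_two_nsmul
  rw [smul_eq_mul] at *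
  exact ⟨metricDim_lGraph (by omega) h2 h3 hl, edgeMetricDim_lGraph (by omega) h2 h3 hl⟩
end

section
/- Let n1 ≥ 5, n2 ≥ 1 and n3 ≥ 2, and let α = ⌊(n1+1)/2⌋ and β = ⌈(n1+3)/2⌉. Then the set S = {j_1, j_2, ..., j_{n3−1}, a_α, a_β} of n3 + 1 vertices is an edge metric generator of the graph G_{n1,n2,n3}. -/
/-- A function vanishing exactly at `z`, which changes by at most one along edges and can always be
decreased by moving to a neighbour, is the distance to `z`. -/
theorem SimpleGraph.dist_eq_of_descent {V : Type*} {G : SimpleGraph V} {z : V} (f : V → ℕ)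
    (hz : f z = 0) (hlip : ∀ u v, G.Adj u v → f u ≤ f v + 1)
    (hdesc : ∀ u, u ≠ z → ∃ v, G.Adj u v ∧ f v + 1 = f u) (u : V) : G.dist u z = f u := by
  have hwalk : ∀ n u, f u = n → ∃ p : G.Walk u z, p.length = n := by
    intro n
    induction n with
    | zero =>
      intro u hu
      by_cases huz : u = z
      · subst huz
        exact ⟨.nil, rfl⟩
      · obtain ⟨v, -, hv⟩ := hdesc u huz
        omega
    | succ n ih =>
      intro u hu
      obtain ⟨v, hadj, hv⟩ := hdesc u (by rintro rfl; omega)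
      obtain ⟨p, hp⟩ := ih v (by omega)
      exact ⟨.cons hadj p, by simp [hp]⟩
  have hle : ∀ {u v : V} (p : G.Walk u v), f u ≤ f v + p.length := by
    intro u v p
    induction p with
    | nil => simp
    | cons h p ih =>
      have := hlip _ _ h
      simp only [SimpleGraph.Walk.length_cons]
      omega
  obtain ⟨p, hp⟩ := hwalk _ u rfl
  obtain ⟨q, hq⟩ := p.reachable.exists_walk_length_eq_dist
  have h₁ := SimpleGraph.dist_le p
  have h₂ := hle q
  omega

namespace GVert

variable {n1 n2 n3 : ℕ}

/-- The distance between positions `k` and `p` on a cycle of length `n`. -/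
def cycleDist (n k p : ℕ) : ℕ := min ((k - p) + (p - k)) (n - ((k - p) + (p - k)))

/-- The distance from a vertex of `G_{n1,n2,n3}` to the cycle vertex in position `p`. -/
def distA (p : ℕ) : GVert n1 n2 n3 → ℕ
  | a k => cycleDist n1 k p
  | b m => cycleDist n1 1 p + m + 1
  | c => cycleDist n1 (n1 - 1) p + 1
  | i => cycleDist n1 0 p + 1
  | j _ => cycleDist n1 0 p + 2

/-- The distance from a vertex of `G_{n1,n2,n3}` to the pendant vertex `j q`. -/
def distJ (q : Fin n3) : GVert n1 n2 n3 → ℕ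
  | a k => cycleDist n1 k 0 + 2
  | b m => m + 4
  | c => 4
  | i => 1
  | j t => if t = q then 0 else 2

theorem adj_a_a {k l : Fin n1} (h : (l : ℕ) = k + 1) :
    (GGraph n1 n2 n3).Adj (a k) (a l) := by
  have := l.2
  refine (SimpleGraph.fromRel_adj _ _ _).2 ⟨by rintro ⟨⟩; omega, .inl ?_⟩
  simp only [GRel]
  rw [Nat.mod_eq_of_lt (by omega), h]

theorem adj_a_a_wrap {k l : Fin n1} (h1 : 2 ≤ n1) (hk : (k : ℕ) = n1 - 1) (hl : (l : ℕ) = 0) :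
    (GGraph n1 n2 n3).Adj (a k) (a l) := by
  refine (SimpleGraph.fromRel_adj _ _ _).2 ⟨by rintro ⟨⟩; omega, .inl ?_⟩
  simp only [GRel]
  rw [hk, hl, Nat.sub_add_cancel (by omega), Nat.mod_self]

theorem adj_a_b {k : Fin n1} {m : Fin n2} (hk : (k : ℕ) = 1) (hm : (m : ℕ) = 0) :
    (GGraph n1 n2 n3).Adj (a k) (b m) :=
  (SimpleGraph.fromRel_adj _ _ _).2 ⟨by rintro ⟨⟩, .inl ⟨hk, hm⟩⟩

theorem adj_b_b {m m' : Fin n2} (h : (m' : ℕ) = m + 1) :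
    (GGraph n1 n2 n3).Adj (b m) (b m') :=
  (SimpleGraph.fromRel_adj _ _ _).2 ⟨by rintro ⟨⟩; omega, .inl h⟩

theorem adj_a_c {k : Fin n1} (hk : (k : ℕ) = n1 - 1) : (GGraph n1 n2 n3).Adj (a k) c :=
  (SimpleGraph.fromRel_adj _ _ _).2 ⟨by rintro ⟨⟩, .inl hk⟩

theorem adj_a_i {k : Fin n1} (hk : (k : ℕ) = 0) : (GGraph n1 n2 n3).Adj (a k) i :=
  (SimpleGraph.fromRel_adj _ _ _).2 ⟨by rintro ⟨⟩, .inl hk⟩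

theorem adj_i_j (t : Fin n3) : (GGraph n1 n2 n3).Adj i (j t) :=
  (SimpleGraph.fromRel_adj _ _ _).2 ⟨by rintro ⟨⟩, .inl trivial⟩

theorem le_add_one_of_adj (f : GVert n1 n2 n3 → ℕ)
    (h : ∀ u v, GRel n1 n2 n3 u v → f u ≤ f v + 1 ∧ f v ≤ f u + 1) (u v : GVert n1 n2 n3)
    (huv : (GGraph n1 n2 n3).Adj u v) : f u ≤ f v + 1 := by
  rcases (SimpleGraph.fromRel_adj _ _ _).1 huv with ⟨-, h' | h'⟩
  · exact (h _ _ h').1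
  · exact (h _ _ h').2

theorem succ_mod_cases {n k l : ℕ} (hk : k < n) (h : l = (k + 1) % n) :
    (k + 1 < n ∧ l = k + 1) ∨ (k + 1 = n ∧ l = 0) := by
  rcases Nat.lt_or_ge (k + 1) n with h' | h'
  · exact .inl ⟨h', by rwa [Nat.mod_eq_of_lt h'] at h⟩
  · have : k + 1 = n := by omega
    exact .inr ⟨this, by rwa [this, Nat.mod_self] at h⟩

theorem exists_adj_cycleDist_lt (h1 : 2 ≤ n1) {p : ℕ} (hp : p < n1) (k : Fin n1)
    (hk : (k : ℕ) ≠ p) : ∃ l : Fin n1, (GGraph n1 n2 n3).Adj (a k) (a l) ∧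
      cycleDist n1 l p + 1 = cycleDist n1 k p := by
  obtain ⟨k, hkn⟩ := k
  have hup : (k < p ∧ p - k ≤ n1 - (p - k)) ∨ (p < k ∧ n1 - (k - p) ≤ k - p) ∨
      (k < p ∧ n1 - (p - k) ≤ p - k) ∨ (p < k ∧ k - p ≤ n1 - (k - p)) := by
    simp only at hk
    omega
  unfold cycleDist
  rcases hup with h | h | h | h
  · exact ⟨⟨k + 1, by omega⟩, adj_a_a rfl, by simp only; omega⟩
  · by_cases hl : k + 1 = n1
    · exact ⟨⟨0, by omega⟩, adj_a_a_wrap h1 (by simp only; omega) rfl, by simp only; omega⟩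
    · exact ⟨⟨k + 1, by omega⟩, adj_a_a rfl, by simp only; omega⟩
  · by_cases hl : k = 0
    · exact ⟨⟨n1 - 1, by omega⟩, (adj_a_a_wrap h1 rfl hl).symm, by simp only; omega⟩
    · exact ⟨⟨k - 1, by omega⟩, (adj_a_a (by simp only; omega)).symm, by simp only; omega⟩
  · exact ⟨⟨k - 1, by omega⟩, (adj_a_a (by simp only; omega)).symm, by simp only; omega⟩

theorem cycleDist_le_of_rel {k l p : ℕ} (hk : k < n1) (hp : p < n1) (h : l = (k + 1) % n1) :
    cycleDist n1 k p ≤ cycleDist n1 l p + 1 ∧ cycleDist n1 l p ≤ cycleDist n1 k p + 1 := by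
  unfold cycleDist
  rcases succ_mod_cases hk h with h | h <;> omega

theorem dist_a (h1 : 2 ≤ n1) (p : Fin n1) (u : GVert n1 n2 n3) :
    (GGraph n1 n2 n3).dist u (a p) = distA p u := by
  refine SimpleGraph.dist_eq_of_descent (distA p) (by simp [distA, cycleDist])
    (le_add_one_of_adj _ ?_) ?_ u
  · rintro (k | m | _ | _ | t) (k' | m' | _ | _ | t') h <;> simp only [GRel] at h <;>
      simp only [distA]
    · exact cycleDist_le_of_rel k.2 p.2 h
    · rw [h.1]; omega
    · rw [h]; omega
    · rw [h]; omega
    · omega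
    · omega
  · rintro (k | m | _ | _ | t) hu
    · obtain ⟨l, hl⟩ := exists_adj_cycleDist_lt (n2 := n2) (n3 := n3) h1 p.2 k
        (fun h => hu (by rw [Fin.ext h]))
      exact ⟨a l, hl⟩
    · obtain ⟨_ | m, hm⟩ := m
      · exact ⟨a ⟨1, by omega⟩, (adj_a_b rfl rfl).symm, by simp [distA]⟩
      · exact ⟨b ⟨m, by omega⟩, (adj_b_b rfl).symm, by simp only [distA]; omega⟩
    · exact ⟨a ⟨n1 - 1, by omega⟩, (adj_a_c rfl).symm, rfl⟩
    · exact ⟨a ⟨0, by omega⟩, (adj_a_i rfl).symm, rfl⟩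
    · exact ⟨i, (adj_i_j t).symm, rfl⟩

theorem dist_j (h1 : 2 ≤ n1) (q : Fin n3) (u : GVert n1 n2 n3) :
    (GGraph n1 n2 n3).dist u (j q) = distJ q u := by
  refine SimpleGraph.dist_eq_of_descent (distJ q) (by simp [distJ])
    (le_add_one_of_adj _ ?_) ?_ u
  · rintro (k | m | _ | _ | t) (k' | m' | _ | _ | t') h <;> simp only [GRel] at h <;>
      simp only [distJ]
    · have := cycleDist_le_of_rel (p := 0) k.2 (by omega) h
      omega
    · rw [h.1, cycleDist]; omega
    · rw [h, cycleDist]; omega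
    · rw [h, cycleDist]; omega
    · omega
    · split_ifs <;> omega
  · rintro (k | m | _ | _ | t) hu
    · by_cases hk : (k : ℕ) = 0
      · exact ⟨i, adj_a_i hk, by simp [distJ, hk, cycleDist]⟩
      · obtain ⟨l, hl, hd⟩ := exists_adj_cycleDist_lt (n2 := n2) (n3 := n3) h1
          (p := 0) (by omega) k hk
        exact ⟨a l, hl, by simp only [distJ]; omega⟩
    · obtain ⟨_ | m, hm⟩ := m
      · exact ⟨a ⟨1, by omega⟩, (adj_a_b rfl rfl).symm, by simp only [distJ, cycleDist]; omega⟩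
      · exact ⟨b ⟨m, by omega⟩, (adj_b_b rfl).symm, rfl⟩
    · exact ⟨a ⟨n1 - 1, by omega⟩, (adj_a_c rfl).symm, by simp only [distJ, cycleDist]; omega⟩
    · exact ⟨j q, adj_i_j q, by simp [distJ]⟩
    · have ht : t ≠ q := fun h => hu (by rw [h])
      exact ⟨i, (adj_i_j t).symm, by simp [distJ, ht]⟩

theorem exists_rel_of_mem_edgeSet {e : Sym2 (GVert n1 n2 n3)}
    (he : e ∈ (GGraph n1 n2 n3).edgeSet) : ∃ u v, GRel n1 n2 n3 u v ∧ e = s(u, v) := by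
  induction e with
  | _ u v =>
    rcases (SimpleGraph.fromRel_adj _ _ _).1 he with ⟨-, h | h⟩
    · exact ⟨u, v, h, rfl⟩
    · exact ⟨v, u, h, Sym2.eq_swap⟩

theorem min_cycleDist {k l p : ℕ} (hk : k < n1) (hp : p < n1) (h : l = (k + 1) % n1) :
    min (cycleDist n1 k p) (cycleDist n1 l p) =
      if k < p then min (p - k - 1) (n1 - p + k) else min (k - p) (n1 - 1 - k + p) := by
  unfold cycleDist
  rcases succ_mod_cases hk h with h | h <;> split_ifs <;> omega

/-- The distances from an edge `uv` of `G_{n1,n2,n3}`, in the orientation of `GRel`, to a pendant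
vertex and to the cycle vertices in positions `A` and `B`, where `A + B = n1`. -/
theorem min_dist_of_rel {A B : ℕ} (h1 : 5 ≤ n1) (hAB : A + B = n1)
    (hA : B = A + 1 ∨ B = A + 2) (q : Fin n3) {u v : GVert n1 n2 n3} (h : GRel n1 n2 n3 u v)
    {x y z : ℕ} (hx : x = min (distJ q u) (distJ q v)) (hy : y = min (distA A u) (distA A v))
    (hz : z = min (distA B u) (distA B v)) :
    (∃ k l, u = a k ∧ v = a l ∧ (l : ℕ) = (k + 1) % n1 ∧ x = min (k : ℕ) (n1 - 1 - k) + 2 ∧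
      y = (if (k : ℕ) = n1 - 1 then A else (k - A) + (A - 1 - k)) ∧
      z = if (k : ℕ) = 0 then A else (k - B) + (B - 1 - k)) ∨
    (∃ k m, u = a k ∧ v = b m ∧ (k : ℕ) = 1 ∧ (m : ℕ) = 0 ∧ x = 3 ∧ y = A - 1 ∧ z = B - 1) ∨
    (∃ m m', u = b m ∧ v = b m' ∧ (m' : ℕ) = m + 1 ∧ x = m + 4 ∧ y = A + m ∧ z = B + m) ∨
    (∃ k, u = a k ∧ v = c ∧ (k : ℕ) = n1 - 1 ∧ x = 3 ∧ y = B - 1 ∧ z = A - 1) ∨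
    (∃ k, u = a k ∧ v = i ∧ (k : ℕ) = 0 ∧ x = 1 ∧ y = A ∧ z = A) ∨
    ∃ t, u = i ∧ v = j t ∧ x = (if t = q then 0 else 1) ∧ y = A + 1 ∧ z = A + 1 := by
  have h₁ : cycleDist n1 1 A = A - 1 ∧ cycleDist n1 1 B = B - 1 ∧ cycleDist n1 1 0 = 1 := by
    unfold cycleDist; omega
  have h₂ : cycleDist n1 (n1 - 1) A = B - 1 ∧ cycleDist n1 (n1 - 1) B = A - 1 ∧
      cycleDist n1 (n1 - 1) 0 = 1 := by
    unfold cycleDist; omega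
  have h₃ : cycleDist n1 0 A = A ∧ cycleDist n1 0 B = A ∧ cycleDist n1 0 0 = 0 := by
    unfold cycleDist; omega
  rcases u with k | m | _ | _ | t <;> rcases v with l | m' | _ | _ | t' <;>
    simp only [GRel] at h <;>
    simp only [distJ, distA] at hx hy hz
  · have hk := k.2
    rw [Nat.add_min_add_right, min_cycleDist k.2 (by omega) h, if_neg (Nat.not_lt_zero _)] at hx
    rw [min_cycleDist k.2 (by omega) h] at hy hz
    exact .inl ⟨k, l, rfl, rfl, h, by omega, by split_ifs at hy ⊢ <;> omega,
      by split_ifs at hz ⊢ <;> omega⟩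
  · rw [h.1] at hx hy hz
    exact .inr (.inl ⟨k, m', rfl, rfl, h.1, h.2, by omega, by omega, by omega⟩)
  · rw [h] at hx hy hz
    exact .inr (.inr (.inr (.inl ⟨k, rfl, rfl, h, by omega, by omega, by omega⟩)))
  · rw [h] at hx hy hz
    exact .inr (.inr (.inr (.inr (.inl ⟨k, rfl, rfl, h, by omega, by omega, by omega⟩))))
  · exact .inr (.inr (.inl ⟨m, m', rfl, rfl, h, by omega, by omega, by omega⟩))
  · exact .inr (.inr (.inr (.inr (.inr ⟨t', rfl, rfl, by split_ifs at hx ⊢ <;> omega, by omega,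
      by omega⟩))))

theorem eq_of_min_dist_eq (h1 : 5 ≤ n1) (h3 : 2 ≤ n3) {u v u' v' : GVert n1 n2 n3}
    (h : GRel n1 n2 n3 u v) (h' : GRel n1 n2 n3 u' v')
    (hj : ∀ q : Fin n3, (q : ℕ) < n3 - 1 →
      min (distJ q u) (distJ q v) = min (distJ q u') (distJ q v'))
    (hα : min (distA ((n1 + 1) / 2 - 1) u) (distA ((n1 + 1) / 2 - 1) v) =
      min (distA ((n1 + 1) / 2 - 1) u') (distA ((n1 + 1) / 2 - 1) v'))
    (hβ : min (distA ((n1 + 4) / 2 - 1) u) (distA ((n1 + 4) / 2 - 1) v) =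
      min (distA ((n1 + 4) / 2 - 1) u') (distA ((n1 + 4) / 2 - 1) v')) :
    u = u' ∧ v = v' := by
  obtain ⟨q, hq⟩ : ∃ q : Fin n3, (q : ℕ) = 0 := ⟨⟨0, by omega⟩, rfl⟩
  have hj0 := hj q (by omega)
  have hAB : (n1 + 1) / 2 - 1 + ((n1 + 4) / 2 - 1) = n1 := by omega
  have hA : (n1 + 4) / 2 - 1 = (n1 + 1) / 2 - 1 + 1 ∨ (n1 + 4) / 2 - 1 = (n1 + 1) / 2 - 1 + 2 := by
    omega
  generalize (n1 + 1) / 2 - 1 = A at *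
  generalize (n1 + 4) / 2 - 1 = B at *
  rcases min_dist_of_rel h1 hAB hA q h rfl rfl rfl with
    ⟨k, l, rfl, rfl, e, hx, hy, hz⟩ | ⟨k, m, rfl, rfl, e, e₂, hx, hy, hz⟩ |
    ⟨m, m₂, rfl, rfl, e, hx, hy, hz⟩ | ⟨k, rfl, rfl, e, hx, hy, hz⟩ |
    ⟨k, rfl, rfl, e, hx, hy, hz⟩ | ⟨t, rfl, rfl, hx, hy, hz⟩ <;>
  rcases min_dist_of_rel h1 hAB hA _ h' hj0 hα hβ with
    ⟨k', l', rfl, rfl, e', hx', hy', hz'⟩ | ⟨k', m', rfl, rfl, e', e₂', hx', hy', hz'⟩ |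
    ⟨m', m₂', rfl, rfl, e', hx', hy', hz'⟩ | ⟨k', rfl, rfl, e', hx', hy', hz'⟩ |
    ⟨k', rfl, rfl, e', hx', hy', hz'⟩ | ⟨t', rfl, rfl, hx', hy', hz'⟩ <;>
  rw [hx] at hx' <;> rw [hy] at hy' <;> rw [hz] at hz' <;>
  simp only [a.injEq, b.injEq, j.injEq, Fin.ext_iff, reduceCtorEq, and_true, true_and,
    and_false, false_and]
  case inl.inl =>
    have hk : (k : ℕ) = k' := by
      have := k.2
      have := k'.2
      clear hj hj0 hα hβ hx hy hz h h' e e'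
      split_ifs at hy' hz' <;> omega
    exact ⟨hk, by rw [e, e', hk]⟩
  case inr.inr.inr.inr.inr.inr.inr.inr.inr.inr =>
    by_contra hne
    simp only [distJ] at hj
    by_cases ht : (t : ℕ) < n3 - 1
    · have := hj t ht
      rw [if_pos rfl, if_neg (fun h => hne (by rw [h]))] at this
      omega
    · have := hj t' (by omega)
      rw [if_pos rfl, if_neg (fun h => hne (by rw [h]))] at this
      omega
  all_goals
    clear hj hj0 hα hβ hx hy hz h h'
    try split_ifs at hx'
    all_goals try split_ifs at hy'
    all_goals try split_ifs at hz'
    all_goals omega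

end GVert

/-- The set `S = {j_1, …, j_{n3-1}, a_α, a_β}`, with `α = ⌊(n1+1)/2⌋` and
`β = ⌈(n1+3)/2⌉`, has `n3 + 1` vertices and is an edge metric generator of
`G_{n1,n2,n3}`.  (Recall `GVert.a k` stands for `a_{k+1}` and `GVert.j q`
for `j_{q+1}`, so `a_α = GVert.a ⟨α-1, _⟩` and `⌈(n1+3)/2⌉ = (n1+4)/2`.) -/
theorem isEdgeMetricGenerator_GGraph (n1 n2 n3 : ℕ) (h1 : 5 ≤ n1) (h2 : 1 ≤ n2) (h3 : 2 ≤ n3) :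
    ∀ S : Set (GVert n1 n2 n3),
      S = {x | ∃ q : Fin n3, (q : ℕ) < n3 - 1 ∧ x = GVert.j q} ∪
          {GVert.a ⟨(n1 + 1) / 2 - 1, by omega⟩, GVert.a ⟨(n1 + 4) / 2 - 1, by omega⟩} →
      S.ncard = n3 + 1 ∧ IsEdgeMetricGenerator (GGraph n1 n2 n3) S := by
  rintro S rfl
  constructor
  · have hJ : {x : GVert n1 n2 n3 | ∃ q : Fin n3, (q : ℕ) < n3 - 1 ∧ x = GVert.j q} =
        Set.range fun q : Fin (n3 - 1) => GVert.j ⟨q, by omega⟩ := by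
      ext x
      constructor
      · rintro ⟨q, hq, rfl⟩
        exact ⟨⟨q, hq⟩, rfl⟩
      · rintro ⟨q, rfl⟩
        exact ⟨_, q.2, rfl⟩
    rw [hJ, Set.ncard_union_eq, Set.ncard_pair, Set.ncard_range_of_injective, Nat.card_fin]
    · omega
    · rintro q q' h
      simpa [Fin.ext_iff] using h
    · simp only [ne_eq, GVert.a.injEq, Fin.mk.injEq]
      omega
    · rw [Set.disjoint_left]
      rintro _ ⟨q, rfl⟩
      simp
  · intro e he f hf hne
    obtain ⟨u, v, h, rfl⟩ := GVert.exists_rel_of_mem_edgeSet he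
    obtain ⟨u', v', h', rfl⟩ := GVert.exists_rel_of_mem_edgeSet hf
    by_contra! hS
    simp only [edgeDist, Sym2.lift_mk] at hS
    have h2' : 2 ≤ n1 := by omega
    have hj : ∀ q : Fin n3, (q : ℕ) < n3 - 1 → _ := fun q hq => hS (GVert.j q) (.inl ⟨q, hq, rfl⟩)
    have hα := hS _ (.inr (.inl rfl))
    have hβ := hS _ (.inr (.inr rfl))
    simp only [GVert.dist_j h2', GVert.dist_a h2'] at hj hα hβ
    obtain ⟨rfl, rfl⟩ := GVert.eq_of_min_dist_eq h1 h3 h h' hj hα hβ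
    exact hne rfl
end
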